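/- arXiv:1808.07127 — 3 statements merged into one kernel-verified Lean document; each statement's English description precedes it below -/
import Mathlib

section
/- For every q ∈ [1,∞], the map w ↦ ‖(1/n)Xᵀw‖_q is Lipschitz on ℝⁿ with respect to the Euclidean norm with Lipschitz constant (1/√n)·N_q(X); that is, for all w, w′ ∈ ℝⁿ, |‖(1/n)Xᵀw‖_q − ‖(1/n)Xᵀw′‖_q| ≤ (1/√n)·N_q(X)·‖w − w′‖₂. -/
open MeasureTheory ProbabilityTheory
open scoped ENNReal NNReal

noncomputable def lqNorm (q : ℝ≥0∞) {L : ℕ} (v : Fin L → ℝ) : ℝ :=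
  (eLpNorm v q Measure.count).toReal

noncomputable def Nq (q : ℝ≥0∞) {n L : ℕ} (X : Fin n → Fin L → ℝ) : ℝ :=
  lqNorm q (fun j => Real.sqrt ((1 / (n : ℝ)) * ∑ i, (X i j) ^ 2))

noncomputable def gaussianVec (n : ℕ) (σ : ℝ) : Measure (Fin n → ℝ) :=
  Measure.pi (fun _ => gaussianReal 0 ⟨σ ^ 2, sq_nonneg σ⟩)

lemma lq_fin (q : ℝ≥0∞) {L : ℕ} (v : Fin L → ℝ) : eLpNorm v q Measure.count ≠ ∞ :=
  (MemLp.of_discrete (f := v) (p := q) (μ := Measure.count)).eLpNorm_ne_top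

lemma lq_sub (q : ℝ≥0∞) (hq : 1 ≤ q) {L : ℕ} (u v : Fin L → ℝ) :
    lqNorm q u ≤ lqNorm q v + lqNorm q (u - v) := by
  unfold lqNorm
  rw [← ENNReal.toReal_add (lq_fin _ _) (lq_fin _ _)]
  apply ENNReal.toReal_mono (ENNReal.add_ne_top.2 ⟨lq_fin _ _, lq_fin _ _⟩)
  have h := eLpNorm_add_le (f := v) (g := u - v) (μ := Measure.count) (p := q)
    (MemLp.of_discrete (p := q)).1 (MemLp.of_discrete (p := q)).1 hq
  simpa using h

lemma lq_bd (q : ℝ≥0∞) {L : ℕ} (u v : Fin L → ℝ) (c : ℝ) (hc : 0 ≤ c)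
    (h : ∀ j, |u j| ≤ c * v j) : lqNorm q u ≤ c * lqNorm q v := by
  have h1 : eLpNorm u q Measure.count ≤ eLpNorm (c • v) q Measure.count :=
    eLpNorm_mono_real (fun j => by simpa using h j)
  have h2 := ENNReal.toReal_mono (lq_fin _ _) h1
  rw [eLpNorm_const_smul, ENNReal.toReal_mul] at h2
  simpa [lqNorm, abs_of_nonneg hc] using h2

lemma lq_half (n L : ℕ) (X : Fin n → Fin L → ℝ)
    (q : ℝ≥0∞) (hq : 1 ≤ q) (w w' : Fin n → ℝ) :
    lqNorm q (fun j => (1 / (n : ℝ)) * ∑ i, X i j * w i)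
        - lqNorm q (fun j => (1 / (n : ℝ)) * ∑ i, X i j * w' i)
      ≤ (1 / Real.sqrt n) * Nq q X * Real.sqrt (∑ i, (w i - w' i) ^ 2) := by
  have h1 := lq_sub q hq (fun j => (1 / (n : ℝ)) * ∑ i, X i j * w i)
    (fun j => (1 / (n : ℝ)) * ∑ i, X i j * w' i)
  have h2 := lq_bd q ((fun j => (1 / (n : ℝ)) * ∑ i, X i j * w i) -
    (fun j => (1 / (n : ℝ)) * ∑ i, X i j * w' i))
    (fun j => Real.sqrt ((1 / (n : ℝ)) * ∑ i, (X i j) ^ 2))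
    ((1 / Real.sqrt n) * Real.sqrt (∑ i, (w i - w' i) ^ 2)) (by positivity) (by
      intro j
      have e : ((fun j => (1 / (n : ℝ)) * ∑ i, X i j * w i) -
          (fun j => (1 / (n : ℝ)) * ∑ i, X i j * w' i)) j
          = (1 / (n : ℝ)) * ∑ i, X i j * (w i - w' i) := by
        simp only [Pi.sub_apply, mul_sub, Finset.sum_sub_distrib]
      have cs := Finset.sum_mul_sq_le_sq_mul_sq Finset.univ (fun i => X i j) (fun i => w i - w' i)
      have cs' := Real.abs_le_sqrt cs
      rw [Real.sqrt_mul (Finset.sum_nonneg fun i _ => sq_nonneg _)] at cs'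
      have hs : (1 / (n : ℝ)) = (1 / Real.sqrt n) * (1 / Real.sqrt n) := by
        rw [div_mul_div_comm, Real.mul_self_sqrt (Nat.cast_nonneg n), one_mul]
      rw [e, abs_mul, abs_of_nonneg (by positivity : (0:ℝ) ≤ 1 / n),
        Real.sqrt_mul (by positivity), Real.sqrt_div zero_le_one, Real.sqrt_one]
      calc _ ≤ (1 / (n : ℝ)) * _ := mul_le_mul_of_nonneg_left cs' (by positivity)
        _ = _ := by rw [hs]; ring)
  unfold Nq
  linarith

/-- Lipschitz property of `w ↦ ‖(1/n)Xᵀw‖_q` w.r.t. the Euclidean norm. -/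
theorem lqNorm_linear_lipschitz
    (n L : ℕ) (hn : 1 ≤ n) (hL : 1 ≤ L) (X : Fin n → Fin L → ℝ)
    (q : ℝ≥0∞) (hq : 1 ≤ q) (w w' : Fin n → ℝ) :
    |lqNorm q (fun j => (1 / (n : ℝ)) * ∑ i, X i j * w i)
        - lqNorm q (fun j => (1 / (n : ℝ)) * ∑ i, X i j * w' i)|
      ≤ (1 / Real.sqrt n) * Nq q X * Real.sqrt (∑ i, (w i - w' i) ^ 2) := by
  rw [abs_le]
  have h1 := lq_half n L X q hq w w'
  have h2 := lq_half n L X q hq w' w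
  have e : ∑ i, (w' i - w i) ^ 2 = ∑ i, (w i - w' i) ^ 2 :=
    Finset.sum_congr rfl fun i _ => by ring
  rw [e] at h2
  constructor <;> linarith
end

section
/- (Proposition 2.1, confidence-region part) Let r*_{α,q} := E[‖(1/n)XᵀW‖_q] + σ N_q(X) √((2/n) log(1/α)) for α ∈ (0,1). Then with probability at least 1 − α over W, every pair (θ̂, μ̂) ∈ ℝ^p × ℝ that is optimal for the program 'minimize μ over (θ,μ) subject to ‖(1/n)∑_{i=1}^n X_i (Y_i − g(V_i,θ))‖_q ≤ r*_{α,q} + μ, h(θ) ∈ Ω, μ ≥ 0' satisfies μ̂ ≤ ‖(1/n)∑_{i=1}^n X_i ( g(V_i,θ*) − g(V_i,θ̂) )‖_q ≤ 2 r*_{α,q} + μ̂. -/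
open MeasureTheory ProbabilityTheory
open scoped ENNReal NNReal

/-- Feasibility for the program (p2-1): the pair `(θ, μ)` satisfies the norm constraint
with threshold `r`, the restriction `h θ ∈ Ω`, and `μ ≥ 0`. -/
def FeasibleP2 {n L k p m : ℕ} (X : Fin n → Fin L → ℝ)
    (g : (Fin k → ℝ) → (Fin p → ℝ) → ℝ) (V : Fin n → Fin k → ℝ) (Y : Fin n → ℝ)
    (h : (Fin p → ℝ) → Fin m → ℝ) (Ω : Set (Fin m → ℝ)) (q : ℝ≥0∞) (r : ℝ)
    (θ : Fin p → ℝ) (μ : ℝ) : Prop :=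
  lqNorm q (fun j => (1 / (n : ℝ)) * ∑ i, X i j * (Y i - g (V i) θ)) ≤ r + μ ∧
    h θ ∈ Ω ∧ 0 ≤ μ

/-- Optimality for the program (p2-1): feasible, and the slack `μ` is minimal. -/
def OptimalP2 {n L k p m : ℕ} (X : Fin n → Fin L → ℝ)
    (g : (Fin k → ℝ) → (Fin p → ℝ) → ℝ) (V : Fin n → Fin k → ℝ) (Y : Fin n → ℝ)
    (h : (Fin p → ℝ) → Fin m → ℝ) (Ω : Set (Fin m → ℝ)) (q : ℝ≥0∞) (r : ℝ)
    (θ : Fin p → ℝ) (μ : ℝ) : Prop :=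
  FeasibleP2 X g V Y h Ω q r θ μ ∧
    ∀ θ' μ', FeasibleP2 X g V Y h Ω q r θ' μ' → μ ≤ μ'


section
open scoped Pointwise

lemma bm1_compact (s : ℝ) (hs0 : 0 < s) (hs1 : s < 1) (K M C : Set ℝ)
    (hK : IsCompact K) (hM : IsCompact M) (hKn : K.Nonempty) (hMn : M.Nonempty)
    (h : ∀ x ∈ K, ∀ y ∈ M, (1 - s) * x + s * y ∈ C) :
    ENNReal.ofReal (1 - s) * volume K + ENNReal.ofReal s * volume M ≤ volume C := by
  obtain ⟨a, haK, ha⟩ := hK.exists_isGreatest hKn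
  obtain ⟨b, hbM, hb⟩ := hM.exists_isLeast hMn
  have e1 : volume ((fun x => (1 - s) * x + s * b) '' K) = ENNReal.ofReal (1 - s) * volume K := by
    have : (fun x => (1 - s) * x + s * b) '' K = (fun x => x + s * b) '' ((1 - s) • K) := by
      ext z
      simp only [Set.mem_image, Set.mem_smul_set, smul_eq_mul, exists_exists_and_eq_and]
    rw [this, Set.image_add_right, measure_preimage_add_right, Measure.addHaar_smul]
    simp [abs_of_pos (sub_pos.2 hs1)]
  have e2 : volume ((fun x => (1 - s) * a + s * x) '' M) = ENNReal.ofReal s * volume M := by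
    have : (fun x => (1 - s) * a + s * x) '' M = (fun x => (1 - s) * a + x) '' (s • M) := by
      ext z
      simp only [Set.mem_image, Set.mem_smul_set, smul_eq_mul, exists_exists_and_eq_and]
    rw [this, Set.image_add_left, measure_preimage_add, Measure.addHaar_smul]
    simp [abs_of_pos hs0]
  rw [← e1, ← e2, ← measure_union₀]
  · apply measure_mono
    rintro z (⟨x, hx, rfl⟩ | ⟨x, hx, rfl⟩)
    · exact h x hx b hbM
    · exact h a haK x hx
  · exact (hM.image (by fun_prop)).measurableSet.nullMeasurableSet
  · refine measure_mono_null (t := {(1 - s) * a + s * b}) ?_ (by simp)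
    rintro z ⟨⟨x, hx, rfl⟩, ⟨y, hy, hxy⟩⟩
    have h1 := ha hx
    have h2 := hb hy
    simp only [Set.mem_singleton_iff] at *
    nlinarith

end

lemma bm1 (s : ℝ) (hs0 : 0 < s) (hs1 : s < 1) (A B C : Set ℝ)
    (hA : MeasurableSet A) (hB : MeasurableSet B) (hAn : A.Nonempty) (hBn : B.Nonempty)
    (h : ∀ x ∈ A, ∀ y ∈ B, (1 - s) * x + s * y ∈ C) :
    ENNReal.ofReal (1 - s) * volume A + ENNReal.ofReal s * volume B ≤ volume C := by
  obtain ⟨a, ha⟩ := hAn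
  obtain ⟨b, hb⟩ := hBn
  have key : ∀ K ⊆ A, IsCompact K → ∀ M ⊆ B, IsCompact M →
      ENNReal.ofReal (1 - s) * volume K + ENNReal.ofReal s * volume M ≤ volume C := by
    intro K hKA hK M hMB hM
    refine le_trans ?_ (bm1_compact s hs0 hs1 (insert a K) (insert b M) C (hK.insert a)
      (hM.insert b) ⟨a, by simp⟩ ⟨b, by simp⟩ ?_)
    · gcongr <;> exact Set.subset_insert _ _
    · intro x hx y hy
      exact h x (Set.insert_subset ha hKA hx) y (Set.insert_subset hb hMB hy)
  rw [hA.measure_eq_iSup_isCompact, hB.measure_eq_iSup_isCompact]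
  simp only [ENNReal.mul_iSup, iSup_and']
  apply ENNReal.biSup_add_biSup_le' (p := fun K => K ⊆ A ∧ IsCompact K) (q := fun K => K ⊆ B ∧ IsCompact K)
  · exact ⟨∅, by simp⟩
  · exact ⟨∅, by simp⟩
  · intro K hK M hM
    exact key K hK.1 hK.2 M hM.1 hM.2

lemma pl_norm (s : ℝ) (hs0 : 0 < s) (hs1 : s < 1) (u v w : ℝ → ℝ)
    (hu : Measurable u) (hv : Measurable v) (hw : Measurable w)
    (hu0 : ∀ x, 0 ≤ u x) (hv0 : ∀ x, 0 ≤ v x) (hw0 : ∀ x, 0 ≤ w x)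
    (hu1 : ∀ x, u x ≤ 1) (hv1 : ∀ x, v x ≤ 1)
    (hu2 : ∀ t < 1, ∃ x, t < u x) (hv2 : ∀ t < 1, ∃ x, t < v x)
    (h : ∀ x y, min (u x) (v y) ≤ w ((1 - s) * x + s * y)) :
    ENNReal.ofReal (1 - s) * (∫⁻ x, ENNReal.ofReal (u x)) +
      ENNReal.ofReal s * (∫⁻ x, ENNReal.ofReal (v x)) ≤ ∫⁻ x, ENNReal.ofReal (w x) := by
  rw [lintegral_eq_lintegral_meas_lt volume (ae_of_all _ hu0) hu.aemeasurable,
    lintegral_eq_lintegral_meas_lt volume (ae_of_all _ hv0) hv.aemeasurable,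
    lintegral_eq_lintegral_meas_lt volume (ae_of_all _ hw0) hw.aemeasurable]
  have mu : Measurable fun t : ℝ => volume {a | t < u a} :=
    Antitone.measurable fun x y hxy => measure_mono fun z hz => lt_of_le_of_lt hxy hz
  have mv : Measurable fun t : ℝ => volume {a | t < v a} :=
    Antitone.measurable fun x y hxy => measure_mono fun z hz => lt_of_le_of_lt hxy hz
  rw [← lintegral_const_mul _ mu, ← lintegral_const_mul _ mv, ← lintegral_add_left (by fun_prop)]
  refine lintegral_mono fun t => ?_
  rcases lt_or_ge t 1 with ht | ht
  · refine bm1 s hs0 hs1 _ _ _ (measurableSet_lt measurable_const hu)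
      (measurableSet_lt measurable_const hv) (hu2 t ht) (hv2 t ht) ?_
    intro x hx y hy
    exact lt_of_lt_of_le (lt_min hx hy) (h x y)
  · have e1 : {a | t < u a} = ∅ := by
      ext z; simpa using (hu1 z).trans ht
    have e2 : {a | t < v a} = ∅ := by
      ext z; simpa using (hv1 z).trans ht
    simp [e1, e2]

lemma ennreal_amgm (s : ℝ) (hs0 : 0 < s) (hs1 : s < 1) (a b : ℝ≥0∞) :
    a ^ (1 - s) * b ^ s ≤ ENNReal.ofReal (1 - s) * a + ENNReal.ofReal s * b := by
  have h1 : ENNReal.ofReal s ≠ 0 := by simpa using hs0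
  have h2 : ENNReal.ofReal (1 - s) ≠ 0 := by simpa using hs1
  rcases eq_or_ne a ⊤ with rfl | ha
  · simp [ENNReal.mul_top h2]
  rcases eq_or_ne b ⊤ with rfl | hb
  · simp [ENNReal.mul_top h1]
  lift a to ℝ≥0 using ha
  lift b to ℝ≥0 using hb
  rw [← ENNReal.coe_rpow_of_nonneg _ (sub_pos.2 hs1).le, ← ENNReal.coe_rpow_of_nonneg _ hs0.le]
  have := NNReal.geom_mean_le_arith_mean2_weighted (1 - s).toNNReal s.toNNReal a b
    (by rw [← Real.toNNReal_add (by linarith) (by linarith)]; simp)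
  rw [Real.coe_toNNReal _ (sub_pos.2 hs1).le, Real.coe_toNNReal _ hs0.le] at this
  simp only [ENNReal.ofReal]
  exact_mod_cast this

lemma pl1 (s : ℝ) (hs0 : 0 < s) (hs1 : s < 1) (u v : ℝ → ℝ≥0∞) (w : ℝ → ℝ) (W : ℝ)
    (hu : Measurable u) (hv : Measurable v) (hw : Measurable w)
    (hw0 : ∀ x, 0 ≤ w x) (hW : ∀ x, w x ≤ W)
    (h : ∀ x y, u x ^ (1 - s) * v y ^ s ≤ ENNReal.ofReal (w ((1 - s) * x + s * y))) :
    (∫⁻ x, u x) ^ (1 - s) * (∫⁻ x, v x) ^ s ≤ ∫⁻ x, ENNReal.ofReal (w x) := by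
  have hs1' : 0 < 1 - s := sub_pos.2 hs1
  by_cases hu0 : ∀ x, u x = 0
  · simp [hu0, hs1']
  by_cases hv0 : ∀ x, v x = 0
  · simp [hv0, hs0]
  push Not at hu0 hv0
  obtain ⟨x0, hx0⟩ := hu0
  obtain ⟨y0, hy0⟩ := hv0
  set S := ⨆ x, u x with hS
  set T := ⨆ x, v x with hT
  have hSx : ∀ x, u x ≤ S := le_iSup u
  have hTx : ∀ x, v x ≤ T := le_iSup v
  have hS0 : S ≠ 0 := fun h0 => hx0 (by simpa [h0] using hSx x0)
  have hT0 : T ≠ 0 := fun h0 => hy0 (by simpa [h0] using hTx y0)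
  have hST : S ^ (1 - s) * T ^ s ≤ ENNReal.ofReal W := by
    have a1 : S ^ (1 - s) = ⨆ x, u x ^ (1 - s) := 
      (ENNReal.orderIsoRpow (1 - s) hs1').map_iSup u
    have a2 : T ^ s = ⨆ x, v x ^ s := (ENNReal.orderIsoRpow s hs0).map_iSup v
    rw [a1, a2, ENNReal.iSup_mul]
    refine iSup_le fun x => ?_
    rw [ENNReal.mul_iSup]
    exact iSup_le fun y => (h x y).trans (ENNReal.ofReal_le_ofReal (hW _))
  have hSr0 : S ^ (1 - s) ≠ 0 := by simp [hS0, ENNReal.rpow_eq_zero_iff, hs1.le]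
  have hTr0 : T ^ s ≠ 0 := by simp [hT0, ENNReal.rpow_eq_zero_iff, hs0.le]
  have hSt : S ≠ ⊤ := by
    rintro h0
    rw [h0, ENNReal.top_rpow_of_pos hs1', ENNReal.top_mul hTr0] at hST
    simp at hST
  have hTt : T ≠ ⊤ := by
    rintro h0
    rw [h0, ENNReal.top_rpow_of_pos hs0, ENNReal.mul_top hSr0] at hST
    simp at hST
  set c := S ^ (1 - s) * T ^ s with hc
  have hc0 : c ≠ 0 := mul_ne_zero hSr0 hTr0
  have hct : c ≠ ⊤ := (hST.trans_lt ENNReal.ofReal_lt_top).ne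
  have hu1 : ∀ x, u x / S ≤ 1 := fun x => ENNReal.div_le_of_le_mul (by simpa using hSx x)
  have hv1 : ∀ x, v x / T ≤ 1 := fun x => ENNReal.div_le_of_le_mul (by simpa using hTx x)
  have hut : ∀ x, u x / S ≠ ⊤ := fun x => ((hu1 x).trans_lt ENNReal.one_lt_top).ne
  have hvt : ∀ x, v x / T ≠ ⊤ := fun x => ((hv1 x).trans_lt ENNReal.one_lt_top).ne
  have approx : ∀ (f : ℝ → ℝ≥0∞) (R : ℝ≥0∞), R = ⨆ x, f x → R ≠ 0 → R ≠ ⊤ →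
      (∀ x, f x / R ≠ ⊤) → ∀ t < (1:ℝ), ∃ x, t < (f x / R).toReal := by
    intro f R hR hR0 hRt hft t ht
    have : ENNReal.ofReal t * R < ⨆ x, f x := by
      rw [← hR]
      calc ENNReal.ofReal t * R < 1 * R := by
            apply ENNReal.mul_lt_mul_left hR0 hRt
            simpa using ht
        _ = R := one_mul R
    obtain ⟨x, hx⟩ := lt_iSup_iff.1 this
    refine ⟨x, ?_⟩
    rcases lt_or_ge t 0 with ht0 | ht0
    · exact ht0.trans_le ENNReal.toReal_nonneg
    rw [← ENNReal.ofReal_lt_iff_lt_toReal ht0 (hft x),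
      ENNReal.lt_div_iff_mul_lt (Or.inl hR0) (Or.inl hRt)]
    exact hx
  have key := pl_norm s hs0 hs1 (fun x => (u x / S).toReal) (fun x => (v x / T).toReal)
    (fun x => w x / c.toReal) (by fun_prop) (by fun_prop) (by fun_prop)
    (fun x => ENNReal.toReal_nonneg) (fun x => ENNReal.toReal_nonneg)
    (fun x => div_nonneg (hw0 x) ENNReal.toReal_nonneg)
    (fun x => ENNReal.toReal_le_of_le_ofReal zero_le_one (by simpa using hu1 x))
    (fun x => ENNReal.toReal_le_of_le_ofReal zero_le_one (by simpa using hv1 x))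
    (approx u S rfl hS0 hSt hut) (approx v T rfl hT0 hTt hvt) ?_
  · have e1 : ∀ x, ENNReal.ofReal (u x / S).toReal = S⁻¹ * u x := fun x => by
      rw [ENNReal.ofReal_toReal (hut x), ENNReal.div_eq_inv_mul]
    have e2 : ∀ x, ENNReal.ofReal (v x / T).toReal = T⁻¹ * v x := fun x => by
      rw [ENNReal.ofReal_toReal (hvt x), ENNReal.div_eq_inv_mul]
    have e3 : ∀ x, ENNReal.ofReal (w x / c.toReal) = c⁻¹ * ENNReal.ofReal (w x) := fun x => by
      rw [ENNReal.ofReal_div_of_pos (ENNReal.toReal_pos hc0 hct), ENNReal.ofReal_toReal hct,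
        ENNReal.div_eq_inv_mul]
    simp only [e1, e2, e3] at key
    rw [lintegral_const_mul _ hu, lintegral_const_mul _ hv, lintegral_const_mul _ (by fun_prop)] at key
    have key2 := (ennreal_amgm s hs0 hs1 _ _).trans key
    rw [ENNReal.mul_rpow_of_nonneg _ _ hs1'.le, ENNReal.mul_rpow_of_nonneg _ _ hs0.le,
      ENNReal.inv_rpow, ENNReal.inv_rpow] at key2
    have : (S ^ (1 - s))⁻¹ * (T ^ s)⁻¹ = c⁻¹ := by
      rw [hc, ENNReal.mul_inv (Or.inl hSr0) (Or.inr hTr0)]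
    rw [mul_mul_mul_comm, this] at key2
    exact (ENNReal.mul_le_mul_iff_right (by simpa using hct) (by simpa using hc0)).1 key2
  · intro x y
    set a := (u x / S).toReal with ha
    set b := (v y / T).toReal with hb
    have ha0 : 0 ≤ a := ENNReal.toReal_nonneg
    have hb0 : 0 ≤ b := ENNReal.toReal_nonneg
    have m1 : min a b ≤ a ^ (1 - s) * b ^ s := by
      have hm : 0 ≤ min a b := le_min ha0 hb0
      calc min a b = min a b ^ (1 - s) * min a b ^ s := by
            rw [← Real.rpow_add_of_nonneg hm hs1'.le hs0.le]; simp
        _ ≤ a ^ (1 - s) * b ^ s := by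
            gcongr
            · exact min_le_left _ _
            · exact min_le_right _ _
    refine m1.trans ?_
    rw [le_div_iff₀ (ENNReal.toReal_pos hc0 hct), ha, hb, ENNReal.toReal_rpow, ENNReal.toReal_rpow,
      ← ENNReal.toReal_mul, ← ENNReal.toReal_mul]
    apply ENNReal.toReal_le_of_le_ofReal (hw0 _)
    refine le_trans (le_of_eq ?_) (h x y)
    rw [hc, mul_mul_mul_comm, ← ENNReal.mul_rpow_of_nonneg _ _ hs1'.le, 
      ← ENNReal.mul_rpow_of_nonneg _ _ hs0.le, ENNReal.div_mul_cancel hS0 hSt,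
      ENNReal.div_mul_cancel hT0 hTt]

lemma g1 (s : ℝ) (hs0 : 0 < s) (hs1 : s < 1) (v : ℝ≥0) (hv : v ≠ 0) (f g : ℝ → ℝ≥0∞) (b : ℝ)
    (hf : Measurable f) (hg : Measurable g)
    (h : ∀ x y, f x ^ (1 - s) * g y ^ s ≤
      ENNReal.ofReal (Real.exp (b + s * (1 - s) * (x - y) ^ 2 / (2 * v)))) :
    (∫⁻ x, f x ∂(gaussianReal 0 v)) ^ (1 - s) * (∫⁻ x, g x ∂(gaussianReal 0 v)) ^ s ≤
      ENNReal.ofReal (Real.exp b) := by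
  have hs1' : 0 < 1 - s := sub_pos.2 hs1
  have hv' : (0 : ℝ) < v := by positivity
  rw [gaussianReal_of_var_ne_zero _ hv,
    lintegral_withDensity_eq_lintegral_mul _ (measurable_gaussianPDF 0 v) hf,
    lintegral_withDensity_eq_lintegral_mul _ (measurable_gaussianPDF 0 v) hg]
  refine (pl1 s hs0 hs1 _ _ (fun x => Real.exp b * gaussianPDFReal 0 v x)
    (Real.exp b * (√(2 * Real.pi * v))⁻¹)
    ((measurable_gaussianPDF 0 v).mul hf) ((measurable_gaussianPDF 0 v).mul hg)
    (by fun_prop)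
    (fun x => mul_nonneg (Real.exp_pos _).le (gaussianPDFReal_nonneg 0 v x)) ?_ ?_).trans ?_
  · intro x
    gcongr
    rw [gaussianPDFReal]
    apply mul_le_of_le_one_right (by positivity)
    rw [Real.exp_le_one_iff]
    apply div_nonpos_of_nonpos_of_nonneg
    · nlinarith [sq_nonneg (x - 0)]
    · positivity
  · intro x y
    simp only [Pi.mul_apply, gaussianPDF]
    rw [ENNReal.mul_rpow_of_nonneg _ _ hs1'.le, ENNReal.mul_rpow_of_nonneg _ _ hs0.le,
      mul_mul_mul_comm]
    refine (mul_le_mul_right (h x y) _).trans ?_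
    rw [ENNReal.ofReal_rpow_of_nonneg (gaussianPDFReal_nonneg _ _ _) hs1'.le,
      ENNReal.ofReal_rpow_of_nonneg (gaussianPDFReal_nonneg _ _ _) hs0.le,
      ← ENNReal.ofReal_mul (Real.rpow_nonneg (gaussianPDFReal_nonneg _ _ _) _),
      ← ENNReal.ofReal_mul (mul_nonneg (Real.rpow_nonneg (gaussianPDFReal_nonneg _ _ _) _)
        (Real.rpow_nonneg (gaussianPDFReal_nonneg _ _ _) _))]
    apply ENNReal.ofReal_le_ofReal
    apply le_of_eq
    simp only [gaussianPDFReal]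
    have hc : (0:ℝ) < (√(2 * Real.pi * v))⁻¹ := by positivity
    set c := (√(2 * Real.pi * v))⁻¹
    rw [Real.mul_rpow hc.le (Real.exp_pos _).le, Real.mul_rpow hc.le (Real.exp_pos _).le,
      mul_mul_mul_comm, ← Real.rpow_add hc, ← Real.exp_mul, ← Real.exp_mul, sub_add_cancel,
      Real.rpow_one, mul_assoc, ← Real.exp_add, ← Real.exp_add, mul_left_comm, ← Real.exp_add]
    congr 2
    field_simp
    ring
  · simp only [ENNReal.ofReal_mul (Real.exp_pos b).le]
    rw [lintegral_const_mul _ (by fun_prop), lintegral_gaussianPDFReal_eq_one 0 hv, mul_one]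

lemma gN (s : ℝ) (hs0 : 0 < s) (hs1 : s < 1) (v : ℝ≥0) (hv : v ≠ 0) (n : ℕ) :
    ∀ (f g : (Fin n → ℝ) → ℝ≥0∞) (b : ℝ) (_ : Measurable f) (_ : Measurable g)
    (_ : ∀ x y, f x ^ (1 - s) * g y ^ s ≤
      ENNReal.ofReal (Real.exp (b + s * (1 - s) * (∑ i, (x i - y i) ^ 2) / (2 * v)))),
    (∫⁻ x, f x ∂(Measure.pi fun _ => gaussianReal 0 v)) ^ (1 - s) *
      (∫⁻ x, g x ∂(Measure.pi fun _ => gaussianReal 0 v)) ^ s ≤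
      ENNReal.ofReal (Real.exp b) := by
  induction n with
  | zero =>
    intro f g b hf hg h
    rw [lintegral_unique, lintegral_unique]
    have := h default default
    simp only [Finset.univ_eq_empty, Finset.sum_empty, mul_zero, zero_div, add_zero] at this
    simp only [measure_univ, mul_one]
    convert this
  | succ n ih =>
    intro f g b hf hg h
    have mp := (measurePreserving_piFinSuccAbove (fun _ : Fin (n + 1) => gaussianReal 0 v) 0).symm
    have he : ∀ z : ℝ × (Fin n → ℝ), (MeasurableEquiv.piFinSuccAbove (fun _ : Fin (n + 1) => ℝ) 0).symm z
        = Fin.cons z.1 z.2 := fun z => by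
      simp [MeasurableEquiv.piFinSuccAbove]
      rfl
    have conv : ∀ f : (Fin (n + 1) → ℝ) → ℝ≥0∞, Measurable f →
        ∫⁻ x, f x ∂(Measure.pi fun _ => gaussianReal 0 v) =
        ∫⁻ a, ∫⁻ x, f (Fin.cons a x) ∂(Measure.pi fun _ => gaussianReal 0 v) ∂(gaussianReal 0 v) := by
      intro f hf
      rw [← mp.lintegral_comp hf, lintegral_prod]
      · simp only [he]
      · exact (hf.comp mp.measurable).aemeasurable
    have mc : Measurable fun z : ℝ × (Fin n → ℝ) => (Fin.cons z.1 z.2 : Fin (n + 1) → ℝ) := by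
      simp only [← he]
      exact mp.measurable
    rw [conv f hf, conv g hg]
    apply g1 s hs0 hs1 v hv
    · exact Measurable.lintegral_prod_right' (hf.comp mc)
    · exact Measurable.lintegral_prod_right' (hg.comp mc)
    · intro x y
      apply ih
      · exact (hf.comp mc).comp measurable_prodMk_left
      · exact (hg.comp mc).comp measurable_prodMk_left
      · intro x' y'
        refine (h _ _).trans (le_of_eq ?_)
        rw [Fin.sum_univ_succ]
        simp only [Fin.cons_zero, Fin.cons_succ]
        congr 2
        ring

lemma ofReal_integral_le' {β : Type*} [MeasurableSpace β] {μ : Measure β} (f : β → ℝ)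
    (hf : Integrable f μ) : ENNReal.ofReal (∫ x, f x ∂μ) ≤ ∫⁻ x, ENNReal.ofReal (f x) ∂μ := by
  rw [integral_eq_lintegral_pos_part_sub_lintegral_neg_part hf]
  refine (ENNReal.ofReal_le_ofReal (sub_le_self _ ENNReal.toReal_nonneg)).trans ?_
  exact ENNReal.ofReal_toReal_le

lemma conc (v : ℝ≥0) (hv : v ≠ 0) (n : ℕ) (F : (Fin n → ℝ) → ℝ) (K : ℝ) (hK : 0 < K)
    (hF : Measurable F)
    (hFi : Integrable F (Measure.pi fun _ => gaussianReal 0 v))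
    (hL : ∀ x y, F x - F y ≤ K * √(∑ i, (x i - y i) ^ 2)) (t : ℝ) (ht : 0 < t) :
    (Measure.pi fun _ => gaussianReal 0 v) {x | (∫ y, F y ∂(Measure.pi fun _ => gaussianReal 0 v)) + t ≤ F x}
      ≤ ENNReal.ofReal (Real.exp (- (t ^ 2 / (2 * (K ^ 2 * v))))) := by
  set γ : Measure (Fin n → ℝ) := Measure.pi fun _ => gaussianReal 0 v with hγ
  set m := ∫ y, F y ∂γ with hm
  have hv' : (0 : ℝ) < v := by positivity
  have step : ∀ s : ℝ, 0 < s → s < 1 → γ {x | m + t ≤ F x} ≤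
      ENNReal.ofReal (Real.exp (- s * (t ^ 2 / (2 * (K ^ 2 * v))))) := by
    intro s hs0 hs1
    have hs1' : 0 < 1 - s := sub_pos.2 hs1
    have hD : 0 < K ^ 2 * v := by positivity
    set D := K ^ 2 * v with hDdef
    set a := t / D with ha
    have ha0 : 0 < a := by positivity
    have main := gN s hs0 hs1 v hv n (fun x => ENNReal.ofReal (Real.exp (s * a * F x)))
      (fun x => ENNReal.ofReal (Real.exp (- ((1 - s) * a * F x)))) (s * (1 - s) * a ^ 2 * D / 2)
      (by fun_prop) (by fun_prop) (by
        intro x y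
        rw [ENNReal.ofReal_rpow_of_pos (Real.exp_pos _), ENNReal.ofReal_rpow_of_pos (Real.exp_pos _),
          ← ENNReal.ofReal_mul (by positivity), ← Real.exp_mul, ← Real.exp_mul, ← Real.exp_add]
        apply ENNReal.ofReal_le_ofReal
        apply Real.exp_le_exp.2
        set S := ∑ i, (x i - y i) ^ 2
        have hS : √S ^ 2 = S := Real.sq_sqrt (Finset.sum_nonneg fun i _ => sq_nonneg _)
        have h1 := hL x y
        have h2 : a * (F x - F y) ≤ a ^ 2 * D / 2 + S / (2 * v) := by
          have : a ^ 2 * D / 2 + S / (2 * v) - a * (K * √S) = (a * K * v - √S) ^ 2 / (2 * v) := by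
            nth_rewrite 1 [← hS]; rw [hDdef]; field_simp; ring
          have h3 : 0 ≤ (a * K * v - √S) ^ 2 / (2 * v) := by positivity
          nlinarith
        have h3 := mul_le_mul_of_nonneg_left h2 (mul_pos hs0 hs1').le
        calc _ = s * (1 - s) * (a * (F x - F y)) := by ring
          _ ≤ _ := h3
          _ = _ := by ring)
    have hB : ENNReal.ofReal (Real.exp (- ((1 - s) * a * m))) ≤
        ∫⁻ x, ENNReal.ofReal (Real.exp (- ((1 - s) * a * F x))) ∂γ := by
      have hi : Integrable (fun x => Real.exp (- ((1 - s) * a * m)) * (1 - (1 - s) * a * (F x - m))) γ := by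
        fun_prop
      have e : ∫ x, Real.exp (- ((1 - s) * a * m)) * (1 - (1 - s) * a * (F x - m)) ∂γ =
          Real.exp (- ((1 - s) * a * m)) := by
        rw [integral_const_mul, integral_sub (by fun_prop) (by fun_prop), integral_const_mul,
          integral_sub (by fun_prop) (by fun_prop), ← hm]
        simp
      rw [← e]
      refine (ofReal_integral_le' _ hi).trans ?_
      refine lintegral_mono fun x => ENNReal.ofReal_le_ofReal ?_
      have := Real.add_one_le_exp (- ((1 - s) * a * (F x - m)))
      calc _ ≤ Real.exp (- ((1 - s) * a * m)) * Real.exp (- ((1 - s) * a * (F x - m))) := by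
            gcongr; linarith
        _ = _ := by rw [← Real.exp_add]; congr 1; ring
    set A := ∫⁻ x, ENNReal.ofReal (Real.exp (s * a * F x)) ∂γ with hA
    have hA1 : A ≤ ENNReal.ofReal (Real.exp (s * a * m + s * a ^ 2 * D / 2)) := by
      have h1 : A ^ (1 - s) * (ENNReal.ofReal (Real.exp (- ((1 - s) * a * m)))) ^ s ≤
          ENNReal.ofReal (Real.exp (s * (1 - s) * a ^ 2 * D / 2)) :=
        le_trans (by gcongr) main
      rw [← ENNReal.rpow_le_rpow_iff hs1', ENNReal.ofReal_rpow_of_pos (Real.exp_pos _), ← Real.exp_mul]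
      rw [ENNReal.ofReal_rpow_of_pos (Real.exp_pos _), ← Real.exp_mul] at h1
      have h2 := mul_le_mul_left h1 (ENNReal.ofReal (Real.exp ((1 - s) * a * m * s)))
      rw [mul_assoc, ← ENNReal.ofReal_mul (by positivity), ← ENNReal.ofReal_mul (by positivity),
        ← Real.exp_add, ← Real.exp_add, neg_mul, neg_add_cancel, Real.exp_zero, ENNReal.ofReal_one,
        mul_one] at h2
      refine h2.trans (le_of_eq ?_)
      congr 2
      ring
    have mk := mul_meas_ge_le_lintegral (μ := γ) (f := fun x => ENNReal.ofReal (Real.exp (s * a * F x)))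
      (by fun_prop) (ENNReal.ofReal (Real.exp (s * a * (m + t))))
    have sub : γ {x | m + t ≤ F x} ≤ γ {x | ENNReal.ofReal (Real.exp (s * a * (m + t))) ≤
        ENNReal.ofReal (Real.exp (s * a * F x))} := by
      apply measure_mono
      intro x hx
      apply ENNReal.ofReal_le_ofReal
      apply Real.exp_le_exp.2
      exact mul_le_mul_of_nonneg_left hx (by positivity)
    have fin := (mul_le_mul_right sub (ENNReal.ofReal (Real.exp (s * a * (m + t))))).trans
      (mk.trans hA1)
    have h2 := mul_le_mul_right fin (ENNReal.ofReal (Real.exp (-(s * a * (m + t)))))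
    rw [← mul_assoc, ← ENNReal.ofReal_mul (by positivity), ← ENNReal.ofReal_mul (by positivity),
        ← Real.exp_add, ← Real.exp_add, neg_add_cancel, Real.exp_zero, ENNReal.ofReal_one,
        one_mul] at h2
    refine h2.trans (le_of_eq ?_)
    congr 2
    rw [ha]
    field_simp
    ring
  have lim : Filter.Tendsto (fun s : ℝ => ENNReal.ofReal (Real.exp (- s * (t ^ 2 / (2 * (K ^ 2 * v))))))
      (nhdsWithin 1 (Set.Iio 1)) (nhds (ENNReal.ofReal (Real.exp (- 1 * (t ^ 2 / (2 * (K ^ 2 * v))))))) := by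
    apply Filter.Tendsto.mono_left _ nhdsWithin_le_nhds
    apply Continuous.tendsto (f := fun s : ℝ => ENNReal.ofReal (Real.exp (- s * (t ^ 2 / (2 * (K ^ 2 * v))))))
    exact ENNReal.continuous_ofReal.comp (by fun_prop)
  rw [neg_one_mul] at lim
  refine ge_of_tendsto lim ?_
  filter_upwards [Ioo_mem_nhdsLT (zero_lt_one' ℝ)] with s hs
  exact step s hs.1 hs.2

lemma lqNorm_top {L : ℕ} (q : ℝ≥0∞) (u : Fin L → ℝ) : eLpNorm u q Measure.count ≠ ⊤ :=
  (MemLp.of_discrete (f := u) (p := q) (μ := Measure.count)).2.ne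

lemma lqNorm_nonneg {L : ℕ} (q : ℝ≥0∞) (u : Fin L → ℝ) : 0 ≤ lqNorm q u := ENNReal.toReal_nonneg

lemma lqNorm_add_le {L : ℕ} (q : ℝ≥0∞) (hq : 1 ≤ q) (u v w : Fin L → ℝ)
    (h : ∀ j, w j = u j + v j) : lqNorm q w ≤ lqNorm q u + lqNorm q v := by
  have : w = u + v := funext h
  subst this
  unfold lqNorm
  rw [← ENNReal.toReal_add (lqNorm_top q u) (lqNorm_top q v)]
  apply ENNReal.toReal_mono (ENNReal.add_ne_top.2 ⟨lqNorm_top q u, lqNorm_top q v⟩)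
  exact eLpNorm_add_le .of_discrete .of_discrete hq

lemma lqNorm_neg {L : ℕ} (q : ℝ≥0∞) (u w : Fin L → ℝ) (h : ∀ j, w j = - u j) :
    lqNorm q w = lqNorm q u := by
  have : w = - u := funext h
  subst this
  unfold lqNorm
  rw [eLpNorm_neg]

lemma lqNorm_le_mul {L : ℕ} (q : ℝ≥0∞) (u w : Fin L → ℝ) (c : ℝ) (hc : 0 ≤ c)
    (h : ∀ j, |w j| ≤ c * u j) : lqNorm q w ≤ c * lqNorm q u := by
  unfold lqNorm
  have h1 : eLpNorm w q Measure.count ≤ eLpNorm (c • u) q Measure.count :=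
    eLpNorm_mono_real h
  rw [eLpNorm_const_smul] at h1
  have := ENNReal.toReal_mono (ENNReal.mul_ne_top (by simp) (lqNorm_top q u)) h1
  rwa [ENNReal.toReal_mul, toReal_enorm, Real.norm_of_nonneg hc] at this

lemma lq_bound {n L : ℕ} (hn : 1 ≤ n) (q : ℝ≥0∞) (X : Fin n → Fin L → ℝ) (z : Fin n → ℝ) :
    lqNorm q (fun j => (1 / (n : ℝ)) * ∑ i, X i j * z i) ≤
      Nq q X / √n * √(∑ i, z i ^ 2) := by
  have hn' : (0 : ℝ) < n := by exact_mod_cast hn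
  have := lqNorm_le_mul q (fun j => Real.sqrt ((1 / (n : ℝ)) * ∑ i, (X i j) ^ 2))
    (fun j => (1 / (n : ℝ)) * ∑ i, X i j * z i) (√(∑ i, z i ^ 2) / √n) (by positivity) (by
      intro j
      rw [← Real.sqrt_div' _ hn'.le, ← Real.sqrt_mul' _ (by positivity)]
      apply Real.abs_le_sqrt
      have := Finset.sum_mul_sq_le_sq_mul_sq Finset.univ (fun i => X i j) z
      calc _ = (1 / (n : ℝ)) ^ 2 * (∑ i, X i j * z i) ^ 2 := by ring
        _ ≤ (1 / (n : ℝ)) ^ 2 * ((∑ i, X i j ^ 2) * ∑ i, z i ^ 2) := by gcongr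
        _ = _ := by ring)
  refine this.trans (le_of_eq ?_)
  unfold Nq
  ring

lemma lq_lip {n L : ℕ} (hn : 1 ≤ n) (q : ℝ≥0∞) (hq : 1 ≤ q) (X : Fin n → Fin L → ℝ)
    (x y : Fin n → ℝ) :
    lqNorm q (fun j => (1 / (n : ℝ)) * ∑ i, X i j * x i) -
      lqNorm q (fun j => (1 / (n : ℝ)) * ∑ i, X i j * y i) ≤
      Nq q X / √n * √(∑ i, (x i - y i) ^ 2) := by
  have h1 := lq_bound hn q X (fun i => x i - y i)
  have h2 := lqNorm_add_le q hq (fun j => (1 / (n : ℝ)) * ∑ i, X i j * y i)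
    (fun j => (1 / (n : ℝ)) * ∑ i, X i j * (x i - y i))
    (fun j => (1 / (n : ℝ)) * ∑ i, X i j * x i) (by
      intro j
      rw [← mul_add, ← Finset.sum_add_distrib]
      congr 1
      exact Finset.sum_congr rfl fun i _ => by ring)
  linarith

lemma cont_of_lip {n : ℕ} (F : (Fin n → ℝ) → ℝ) (K : ℝ)
    (hL : ∀ x y, F x - F y ≤ K * √(∑ i, (x i - y i) ^ 2)) : Continuous F := by
  rw [continuous_iff_continuousAt]
  intro a
  rw [ContinuousAt, tendsto_iff_dist_tendsto_zero]
  have hc : Continuous fun x : Fin n → ℝ => K * √(∑ i, (x i - a i) ^ 2) := by fun_prop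
  have h0 := hc.tendsto a
  simp only [sub_self, ne_eq, OfNat.ofNat_ne_zero, not_false_eq_true, zero_pow,
    Finset.sum_const_zero, Real.sqrt_zero, mul_zero] at h0
  refine squeeze_zero (fun _ => dist_nonneg) (fun x => ?_) h0
  rw [Real.dist_eq, abs_le]
  have h1 := hL x a
  have h2 := hL a x
  have e : ∑ i, (a i - x i) ^ 2 = ∑ i, (x i - a i) ^ 2 :=
    Finset.sum_congr rfl fun i _ => by ring
  rw [e] at h2
  constructor <;> linarith

lemma gv_eq (n : ℕ) (σ : ℝ) : ∃ v : ℝ≥0, (v : ℝ) = σ ^ 2 ∧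
    gaussianVec n σ = Measure.pi fun _ => gaussianReal 0 v :=
  ⟨NNReal.mk (σ ^ 2) (sq_nonneg σ), rfl, rfl⟩

lemma prob_event {n L : ℕ} (hn : 1 ≤ n) (X : Fin n → Fin L → ℝ) (σ : ℝ) (hσ : 0 < σ)
    (q : ℝ≥0∞) (hq : 1 ≤ q) (α : ℝ) (hα : α ∈ Set.Ioo (0 : ℝ) 1) :
    1 - ENNReal.ofReal α ≤ gaussianVec n σ {w | lqNorm q (fun j => (1 / (n : ℝ)) * ∑ i, X i j * w i) ≤
      (∫ w', lqNorm q (fun j => (1 / (n : ℝ)) * ∑ i, X i j * w' i) ∂(gaussianVec n σ)) +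
              σ * Nq q X * Real.sqrt ((2 / (n : ℝ)) * Real.log (1 / α))} := by
  have hn' : (0 : ℝ) < n := by exact_mod_cast hn
  obtain ⟨hα0, hα1⟩ := hα
  have hpm : IsProbabilityMeasure (gaussianVec n σ) := by
    obtain ⟨v, _, hv⟩ := gv_eq n σ
    rw [hv]
    infer_instance
  set F : (Fin n → ℝ) → ℝ := fun w => lqNorm q (fun j => (1 / (n : ℝ)) * ∑ i, X i j * w i) with hF
  have hlip := lq_lip hn q hq X
  have hcont : Continuous F := cont_of_lip F _ hlip
  have hF0 : ∀ w, 0 ≤ F w := fun w => lqNorm_nonneg _ _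
  have hN0 : 0 ≤ Nq q X := lqNorm_nonneg _ _
  obtain ⟨v, hv2, hgv⟩ := gv_eq n σ
  rcases hN0.eq_or_lt with hN | hN
  · have : ∀ w, F w = 0 := fun w => le_antisymm (by
      have := lq_bound hn q X w
      rw [← hN, zero_div, zero_mul] at this
      exact this) (hF0 w)
    have hu : {w : Fin n → ℝ | F w ≤ (∫ w', F w' ∂(gaussianVec n σ)) +
        σ * Nq q X * Real.sqrt ((2 / (n : ℝ)) * Real.log (1 / α))} = Set.univ := by
      ext w
      simp [this, ← hN]
    have hu2 := congrArg (gaussianVec n σ) hu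
    rw [measure_univ] at hu2
    exact tsub_le_self.trans hu2.ge
  have hint : Integrable F (gaussianVec n σ) := by
    have hi : Integrable (fun w : Fin n → ℝ => Nq q X / √n * ∑ i, |w i|) (gaussianVec n σ) := by
      apply Integrable.const_mul
      apply integrable_finsetSum
      intro i _
      apply Integrable.abs
      have h1 : Integrable id (gaussianReal 0 v) := by
        have := memLp_id_gaussianReal (μ := 0) (v := v) 1
        exact memLp_one_iff_integrable.1 (by simpa using this)
      have mp : MeasurePreserving (Function.eval i) (gaussianVec n σ) (gaussianReal 0 v) := by
        rw [hgv]
        exact measurePreserving_eval (fun _ : Fin n => gaussianReal 0 v) i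
      exact mp.integrable_comp_of_integrable h1
    refine hi.mono' hcont.aestronglyMeasurable (Filter.Eventually.of_forall fun w => ?_)
    rw [Real.norm_of_nonneg (hF0 w)]
    refine (lq_bound hn q X w).trans ?_
    gcongr
    rw [Real.sqrt_le_left (Finset.sum_nonneg fun i _ => abs_nonneg _)]
    calc ∑ i, w i ^ 2 = ∑ i, |w i| ^ 2 := by simp
      _ ≤ (∑ i, |w i|) ^ 2 := Finset.sum_sq_le_sq_sum_of_nonneg fun i _ => abs_nonneg _
  have hlog : 0 < Real.log (1 / α) := Real.log_pos (by rw [lt_div_iff₀ hα0]; linarith)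
  set t := σ * Nq q X * Real.sqrt ((2 / (n : ℝ)) * Real.log (1 / α)) with ht
  have ht0 : 0 < t := by positivity
  have hvne : v ≠ 0 := by
    rintro rfl
    have : (0 : ℝ) < σ ^ 2 := by positivity
    rw [← hv2] at this
    simp at this
  have hc := conc v hvne n F (Nq q X / √n) (by positivity) hcont.measurable
    (hgv ▸ hint) hlip t ht0
  have hexp : Real.exp (- (t ^ 2 / (2 * ((Nq q X / √n) ^ 2 * (v : ℝ))))) = α := by
    have : t ^ 2 / (2 * ((Nq q X / √n) ^ 2 * σ ^ 2)) = Real.log (1 / α) := by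
      rw [ht, mul_pow, Real.sq_sqrt (by positivity), div_pow, Real.sq_sqrt hn'.le]
      field_simp
    rw [hv2, this, one_div, Real.log_inv, neg_neg, Real.exp_log hα0]
  rw [hexp, ← hgv] at hc
  have hms : MeasurableSet {x | (∫ y, F y ∂(gaussianVec n σ)) + t ≤ F x} :=
    measurableSet_le measurable_const hcont.measurable
  calc 1 - ENNReal.ofReal α
      ≤ 1 - gaussianVec n σ {x | (∫ y, F y ∂(gaussianVec n σ)) + t ≤ F x} := by gcongr
    _ = gaussianVec n σ {x | (∫ y, F y ∂(gaussianVec n σ)) + t ≤ F x}ᶜ :=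
        (prob_compl_eq_one_sub hms).symm
    _ ≤ _ := measure_mono fun x hx => by
        simp only [Set.mem_compl_iff, Set.mem_ofPred_eq, not_le] at hx ⊢
        exact hx.le

/-- Proposition 2.1, confidence-region part. -/
theorem ideal_confidence_region
    (n L k p m : ℕ) (hn : 1 ≤ n) (hL : 1 ≤ L) (hk : 1 ≤ k) (hp : 1 ≤ p) (hm : 1 ≤ m)
    (X : Fin n → Fin L → ℝ) (g : (Fin k → ℝ) → (Fin p → ℝ) → ℝ)
    (V : Fin n → Fin k → ℝ) (θs : Fin p → ℝ) (σ : ℝ) (hσ : 0 < σ)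
    (h : (Fin p → ℝ) → Fin m → ℝ) (Ω : Set (Fin m → ℝ))
    (hΩne : Ω.Nonempty) (hΩcl : IsClosed Ω)
    (hΘ0 : {θ : Fin p → ℝ | h θ ∈ Ω}.Nonempty)
    (q : ℝ≥0∞) (hq : 1 ≤ q) (α : ℝ) (hα : α ∈ Set.Ioo (0 : ℝ) 1) :
    (gaussianVec n σ {w : Fin n → ℝ |
        ∀ θh μh, OptimalP2 X g V (fun i => g (V i) θs + w i) h Ω q
            ((∫ w', lqNorm q (fun j => (1 / (n : ℝ)) * ∑ i, X i j * w' i)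
                ∂(gaussianVec n σ)) +
              σ * Nq q X * Real.sqrt ((2 / (n : ℝ)) * Real.log (1 / α))) θh μh →
          μh ≤ lqNorm q (fun j =>
              (1 / (n : ℝ)) * ∑ i, X i j * (g (V i) θs - g (V i) θh)) ∧
            lqNorm q (fun j =>
                (1 / (n : ℝ)) * ∑ i, X i j * (g (V i) θs - g (V i) θh))
              ≤ 2 * ((∫ w', lqNorm q (fun j => (1 / (n : ℝ)) * ∑ i, X i j * w' i)
                  ∂(gaussianVec n σ)) +
                σ * Nq q X * Real.sqrt ((2 / (n : ℝ)) * Real.log (1 / α))) + μh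
        }).toReal ≥ 1 - α := by
  have hpm : IsProbabilityMeasure (gaussianVec n σ) := by
    obtain ⟨v, _, hv⟩ := gv_eq n σ
    rw [hv]
    infer_instance
  have hev := prob_event hn X σ hσ q hq α hα
  set r := (∫ w', lqNorm q (fun j => (1 / (n : ℝ)) * ∑ i, X i j * w' i) ∂(gaussianVec n σ)) +
              σ * Nq q X * Real.sqrt ((2 / (n : ℝ)) * Real.log (1 / α)) with hr
  have e1 : 1 - α = (1 - ENNReal.ofReal α).toReal := by
    rw [← ENNReal.ofReal_one, ← ENNReal.ofReal_sub _ hα.1.le,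
      ENNReal.toReal_ofReal (by linarith [hα.2])]
  rw [ge_iff_le, e1]
  apply ENNReal.toReal_mono (measure_ne_top _ _)
  refine hev.trans (measure_mono ?_)
  intro w hw θh μh hopt
  simp only [Set.mem_ofPred_eq] at hw
  obtain ⟨⟨hf1, hf2, hf3⟩, hmin⟩ := hopt
  constructor
  · apply hmin θh
    refine ⟨?_, hf2, lqNorm_nonneg _ _⟩
    refine (lqNorm_add_le q hq (fun j => (1 / (n : ℝ)) * ∑ i, X i j * w i)
      (fun j => (1 / (n : ℝ)) * ∑ i, X i j * (g (V i) θs - g (V i) θh)) _ ?_).trans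
      (by linarith)
    intro j
    rw [← mul_add, ← Finset.sum_add_distrib]
    congr 1
    exact Finset.sum_congr rfl fun i _ => by ring
  · have hneg := lqNorm_neg q (fun j => (1 / (n : ℝ)) * ∑ i, X i j * w i)
      (fun j => - ((1 / (n : ℝ)) * ∑ i, X i j * w i)) (fun _ => rfl)
    refine (lqNorm_add_le q hq
      (fun j => (1 / (n : ℝ)) * ∑ i, X i j * (g (V i) θs + w i - g (V i) θh))
      (fun j => - ((1 / (n : ℝ)) * ∑ i, X i j * w i)) _ ?_).trans (by linarith)
    intro j
    rw [← sub_eq_add_neg, ← mul_sub, ← Finset.sum_sub_distrib]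
    congr 1
    exact Finset.sum_congr rfl fun i _ => by ring
end

section
/- (Monte Carlo upper-deviation bound, eq. (c2_u)) Let Z₁,…,Z_R be i.i.d. N(0, I_n) random vectors and let W ~ N(0, σ²I_n). Then for every q ∈ [1,∞] and every t ≥ 0, P{ (σ/R) ∑_{r=1}^R ‖(1/n)XᵀZ_r‖_q ≥ E[‖(1/n)XᵀW‖_q] + t } ≤ exp( −nR t² / (2σ² N_q(X)²) ). -/
open MeasureTheory ProbabilityTheory
open scoped ENNReal NNReal

set_option linter.unusedSectionVars false

section conc
variable {E : Type*} [NormedAddCommGroup E] [InnerProductSpace ℝ E] [FiniteDimensional ℝ E]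
  [MeasurableSpace E] [BorelSpace E]

structure Sm (G : E → ℝ) (K C : ℝ) : Prop where
  diff : Differentiable ℝ G
  bd : ∀ x, ‖fderiv ℝ G x‖ ≤ K
  lip : ∀ x y, ‖fderiv ℝ G x - fderiv ℝ G y‖ ≤ C * ‖x - y‖

lemma Sm.abs_sub_le {G : E → ℝ} {K C : ℝ} (h : Sm G K C) (x y : E) :
    |G (x + y) - G x| ≤ K * ‖y‖ := by
  have := Convex.norm_image_sub_le_of_norm_fderiv_le (𝕜 := ℝ) (f := G) (C := K) (s := Set.univ)
    (x := x) (y := x + y)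
    (fun z _ => h.diff z) (fun z _ => h.bd z) convex_univ trivial trivial
  simpa using this

lemma Sm.taylor {G : E → ℝ} {K C : ℝ} (h : Sm G K C) (hC : 0 ≤ C) (x y : E) :
    |G (x + y) - G x - fderiv ℝ G x y| ≤ C * ‖y‖ ^ 2 := by
  have := Convex.norm_image_sub_le_of_norm_fderiv_le' (𝕜 := ℝ) (f := G) (C := C * ‖y‖)
    (s := Metric.closedBall x ‖y‖) (φ := fderiv ℝ G x)
    (x := x) (y := x + y)
    (fun z _ => h.diff z) (fun z hz => (h.lip z x).trans (by
      rw [mem_closedBall_iff_norm] at hz; gcongr)) (convex_closedBall _ _) (by simp) (by simp)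
  simp only [add_sub_cancel_left, Real.norm_eq_abs] at this
  linarith [this, sq ‖y‖, mul_assoc C ‖y‖ ‖y‖]

lemma integrable_exp_norm (μ : Measure E) [IsGaussian μ] (c : ℝ) :
    Integrable (fun x => Real.exp (c * ‖x‖)) μ := by
  obtain ⟨a, ha, hi⟩ := IsGaussian.exists_integrable_exp_sq μ
  refine (hi.const_mul (Real.exp (c ^ 2 / (4 * a)))).mono' (by fun_prop) ?_
  refine Filter.Eventually.of_forall fun x => ?_
  rw [Real.norm_eq_abs, Real.abs_exp, ← Real.exp_add]
  apply Real.exp_le_exp.2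
  have : c ^ 2 / (4 * a) + a * ‖x‖ ^ 2 - c * ‖x‖ = (c - 2 * a * ‖x‖) ^ 2 / (4 * a) := by
    field_simp; ring
  have h2 : 0 ≤ (c - 2 * a * ‖x‖) ^ 2 / (4 * a) := by positivity
  linarith

lemma exp_taylor (y : ℝ) : Real.exp y ≤ 1 + y + y ^ 2 / 2 + |y| ^ 3 * Real.exp |y| := by
  have h := Complex.norm_exp_sub_sum_le_norm_mul_exp (y : ℂ) 3
  have e : Complex.exp (y:ℂ) - ∑ m ∈ Finset.range 3, (y:ℂ) ^ m / (m.factorial : ℂ) =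
      ((Real.exp y - (1 + y + y ^ 2 / 2) : ℝ) : ℂ) := by
    simp [Finset.sum_range_succ]
  rw [e, Complex.norm_real, Complex.norm_real, Real.norm_eq_abs, Real.norm_eq_abs] at h
  linarith [le_abs_self (Real.exp y - (1 + y + y ^ 2 / 2))]

lemma integrable_lip {μ : Measure E} [IsGaussian μ] {G : E → ℝ} {K : ℝ} (hc : Continuous G)
    (h : ∀ x y, |G (x + y) - G x| ≤ K * ‖y‖) : Integrable G μ := by
  refine (((IsGaussian.integrable_id (μ := μ)).norm.const_mul K).add
    (integrable_const |G 0|)).mono' hc.aestronglyMeasurable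
    (Filter.Eventually.of_forall fun x => ?_)
  have := h 0 x
  simp only [zero_add] at this
  simp only [Pi.add_apply, id, Real.norm_eq_abs]
  have h2 : |G x| ≤ |G x - G 0| + |G 0| := by simpa using abs_add_le (G x - G 0) (G 0)
  linarith

lemma integrable_exp_lip {μ : Measure E} [IsGaussian μ] {G : E → ℝ} {K : ℝ} (hc : Continuous G)
    (h : ∀ x y, |G (x + y) - G x| ≤ K * ‖y‖) : Integrable (fun x => Real.exp (G x)) μ := by
  refine ((integrable_exp_norm μ K).const_mul (Real.exp (G 0))).mono' (by fun_prop)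
    (Filter.Eventually.of_forall fun x => ?_)
  have := h 0 x
  simp only [zero_add] at this
  rw [Real.norm_eq_abs, Real.abs_exp, ← Real.exp_add]
  apply Real.exp_le_exp.2
  linarith [le_abs_self (G x - G 0)]

lemma integral_sq_dual (l : StrongDual ℝ E) : ∫ z, (l z) ^ 2 ∂(stdGaussian E) = ‖l‖ ^ 2 := by
  rw [← variance_dual_stdGaussian, variance_eq_integral (by fun_prop),
    integral_strongDual_stdGaussian]
  simp

lemma one_step (K C : ℝ) (hK : 0 ≤ K) (hC : 0 ≤ C) : ∃ A : ℝ, 0 ≤ A ∧ ∀ G : E → ℝ, Sm G K C →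
    ∀ s : ℝ, 0 ≤ s → s ≤ 1 → ∀ x : E,
    ∫ z, Real.exp (G (x + s • z)) ∂(stdGaussian E) ≤
      Real.exp (∫ z, G (x + s • z) ∂(stdGaussian E) + s ^ 2 * K ^ 2 / 2 + s ^ 3 * A) := by
  set γ := stdGaussian E with hγ
  set m1 := ∫ z, ‖z‖ ∂γ with hm1
  have hm1' : 0 ≤ m1 := integral_nonneg fun z => norm_nonneg _
  have hn : Integrable (fun z : E => ‖z‖) γ := IsGaussian.integrable_id.norm
  let B : E → ℝ := fun z => 6 * Real.exp (2 * (K * (‖z‖ + m1))) +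
    (6 * K * C + 12 * C ^ 2) * Real.exp ‖z‖
  have hB0 : ∀ z, 0 ≤ B z := fun z => by positivity
  have hBi : Integrable B γ := by
    refine Integrable.add ?_ ?_
    · have := (integrable_exp_norm γ (2 * K)).const_mul (6 * Real.exp (2 * K * m1))
      refine this.congr (Filter.Eventually.of_forall fun z => ?_)
      simp only
      rw [mul_assoc, ← Real.exp_add]; ring_nf
    · have := (integrable_exp_norm γ 1)
      simp only [one_mul] at this
      exact this.const_mul _
  refine ⟨∫ z, B z ∂γ, integral_nonneg hB0, fun G hG s hs0 hs1 x => ?_⟩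
  have hGc := hG.diff.continuous
  set D : E → ℝ := fun z => G (x + s • z) - G x with hD
  have hDb : ∀ z, |D z| ≤ K * (s * ‖z‖) := fun z => by
    have := hG.abs_sub_le x (s • z)
    rwa [norm_smul, Real.norm_of_nonneg hs0] at this
  have hDi : Integrable D γ := by
    refine (hn.const_mul (K * s)).mono' (by fun_prop) (Filter.Eventually.of_forall fun z => ?_)
    rw [Real.norm_eq_abs]; linarith [hDb z]
  set d := ∫ z, D z ∂γ with hd
  have hdb : |d| ≤ K * (s * m1) := by
    calc |d| ≤ ∫ z, |D z| ∂γ := abs_integral_le_integral_abs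
      _ ≤ ∫ z, K * (s * ‖z‖) ∂γ := integral_mono hDi.abs ((hn.const_mul s).const_mul K) hDb
      _ = _ := by rw [integral_const_mul, integral_const_mul]
  set l := fderiv ℝ G x with hl
  have hli : Integrable (fun z => (l z) ^ 2) γ :=
    (IsGaussian.memLp_dual γ l 2 (by simp)).integrable_sq
  have key : ∀ z, Real.exp (D z - d) ≤ 1 + (D z - d) + s ^ 2 / 2 * (l z) ^ 2 - d * D z + d ^ 2 / 2
      + s ^ 3 * B z := by
    intro z
    set u := K * (‖z‖ + m1) with hu
    have hu0 : 0 ≤ u := by positivity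
    have hY : |D z - d| ≤ s * u := by
      have := abs_sub (D z) d
      have e : s * u = K * (s * ‖z‖) + K * (s * m1) := by rw [hu]; ring
      rw [e]; linarith [hDb z]
    have h1 : |D z - d| ^ 3 * Real.exp |D z - d| ≤ s ^ 3 * (6 * Real.exp (2 * u)) := by
      have hu3 : u ^ 3 ≤ 6 * Real.exp u := by
        have := Real.pow_div_factorial_le_exp u hu0 3
        norm_num [Nat.factorial] at this; linarith
      calc |D z - d| ^ 3 * Real.exp |D z - d| ≤ (s * u) ^ 3 * Real.exp u := by
            gcongr
            exact hY.trans (mul_le_of_le_one_left hu0 hs1)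
        _ = s ^ 3 * (u ^ 3 * Real.exp u) := by ring
        _ ≤ s ^ 3 * (6 * Real.exp u * Real.exp u) := by gcongr
        _ = _ := by rw [two_mul, Real.exp_add]; ring
    set r := D z - s * l z with hr
    have hrb : |r| ≤ C * (s ^ 2 * ‖z‖ ^ 2) := by
      have := hG.taylor hC x (s • z)
      rw [norm_smul, Real.norm_of_nonneg hs0, map_smul, smul_eq_mul] at this
      rw [hr]; linarith [this, mul_pow s ‖z‖ 2, congrArg (C * ·) (mul_pow s ‖z‖ 2)]
    have hlb : |l z| ≤ K * ‖z‖ := by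
      have := l.le_opNorm z
      rw [Real.norm_eq_abs] at this
      exact this.trans (by gcongr; exact hG.bd x)
    have h2 : D z ^ 2 ≤ s ^ 2 * (l z) ^ 2 + s ^ 3 * (2 * ((6 * K * C + 12 * C ^ 2) * Real.exp ‖z‖)) := by
      have e : D z ^ 2 = s ^ 2 * (l z) ^ 2 + (2 * (s * l z) * r + r ^ 2) := by rw [hr]; ring
      have h3 : ‖z‖ ^ 3 ≤ 6 * Real.exp ‖z‖ := by
        have := Real.pow_div_factorial_le_exp ‖z‖ (norm_nonneg _) 3
        norm_num [Nat.factorial] at this; linarith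
      have h4 : ‖z‖ ^ 4 ≤ 24 * Real.exp ‖z‖ := by
        have := Real.pow_div_factorial_le_exp ‖z‖ (norm_nonneg _) 4
        norm_num [Nat.factorial] at this; linarith
      have a1 : 2 * (s * l z) * r ≤ s ^ 3 * (2 * K * C * ‖z‖ ^ 3) := by
        calc 2 * (s * l z) * r ≤ |2 * (s * l z) * r| := le_abs_self _
          _ = 2 * s * (|l z| * |r|) := by
            rw [abs_mul, abs_mul, abs_mul, abs_of_nonneg hs0, abs_two]; ring
          _ ≤ 2 * s * ((K * ‖z‖) * (C * (s ^ 2 * ‖z‖ ^ 2))) := by gcongr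
          _ = _ := by ring
      have a2 : r ^ 2 ≤ s ^ 3 * (C ^ 2 * ‖z‖ ^ 4) := by
        calc r ^ 2 = |r| ^ 2 := (sq_abs r).symm
          _ ≤ (C * (s ^ 2 * ‖z‖ ^ 2)) ^ 2 := by gcongr
          _ = s * (s ^ 3 * (C ^ 2 * ‖z‖ ^ 4)) := by ring
          _ ≤ _ := mul_le_of_le_one_left (by positivity) hs1
      have a3 : 2 * K * C * ‖z‖ ^ 3 + C ^ 2 * ‖z‖ ^ 4 ≤ 2 * ((6 * K * C + 12 * C ^ 2) * Real.exp ‖z‖) := by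
        have b1 : 2 * K * C * ‖z‖ ^ 3 ≤ 2 * K * C * (6 * Real.exp ‖z‖) := by gcongr
        have b2 : C ^ 2 * ‖z‖ ^ 4 ≤ C ^ 2 * (24 * Real.exp ‖z‖) := by gcongr
        linarith
      have a4 := mul_le_mul_of_nonneg_left a3 (pow_nonneg hs0 3)
      rw [e]; linarith
    have h0 := exp_taylor (D z - d)
    have hBz : s ^ 3 * B z = s ^ 3 * (6 * Real.exp (2 * u)) + s ^ 3 * ((6 * K * C + 12 * C ^ 2) * Real.exp ‖z‖) := by
      simp only [B, hu]; ring
    rw [hBz]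
    nlinarith [h0, h1, h2]
  have hI : ∫ z, Real.exp (D z - d) ∂γ ≤ 1 + s ^ 2 / 2 * ‖l‖ ^ 2 + s ^ 3 * ∫ z, B z ∂γ := by
    have i0 : Integrable (fun z => D z - d) γ := hDi.sub (integrable_const _)
    have i1 : Integrable (fun z => 1 + (D z - d)) γ := (integrable_const _).add i0
    have i2 : Integrable (fun z => 1 + (D z - d) + s ^ 2 / 2 * (l z) ^ 2) γ :=
      i1.add (hli.const_mul _)
    have i3 : Integrable (fun z => 1 + (D z - d) + s ^ 2 / 2 * (l z) ^ 2 - d * D z) γ :=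
      i2.sub (hDi.const_mul _)
    have i4 : Integrable (fun z => 1 + (D z - d) + s ^ 2 / 2 * (l z) ^ 2 - d * D z + d ^ 2 / 2) γ :=
      i3.add (integrable_const _)
    have i5 := i4.add (hBi.const_mul (s ^ 3))
    refine (integral_mono_of_nonneg (Filter.Eventually.of_forall fun z => (Real.exp_pos _).le) i5
      (Filter.Eventually.of_forall key)).trans ?_
    have := integral_add i4 (hBi.const_mul (s ^ 3))
    simp only [Pi.add_def]
    rw [this, integral_add i3 (integrable_const _), integral_sub i2 (hDi.const_mul _),
      integral_add i1 (hli.const_mul _), integral_add (integrable_const _) i0, integral_sub hDi (integrable_const _),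
      integral_const_mul, integral_const_mul, integral_const_mul, integral_sq_dual, ← hd]
    simp
    nlinarith [sq_nonneg d]
  have hW : Integrable (fun z => G (x + s • z)) γ := by
    have := hDi.add (integrable_const (G x))
    refine this.congr (Filter.Eventually.of_forall fun z => ?_)
    simp [hD]
  have hm : d = ∫ z, G (x + s • z) ∂γ - G x := by
    rw [hd, hD, integral_sub hW (integrable_const _)]; simp
  have hexp : ∀ z, Real.exp (G (x + s • z)) = Real.exp (∫ z, G (x + s • z) ∂γ) * Real.exp (D z - d) := by
    intro z
    rw [← Real.exp_add, hm]; congr 1; simp only [hD]; ring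
  simp_rw [hexp]
  rw [integral_const_mul, add_assoc, Real.exp_add]
  gcongr
  refine hI.trans ?_
  have : ‖l‖ ^ 2 ≤ K ^ 2 := by gcongr; exact hG.bd x
  have h3 := Real.add_one_le_exp (s ^ 2 * K ^ 2 / 2 + s ^ 3 * ∫ z, B z ∂γ)
  nlinarith [mul_le_mul_of_nonneg_left this (sq_nonneg s)]
end conc

section conc2
variable {E : Type*} [NormedAddCommGroup E] [InnerProductSpace ℝ E] [FiniteDimensional ℝ E]
  [MeasurableSpace E] [BorelSpace E]

lemma Sm.cont_fderiv {G : E → ℝ} {K C : ℝ} (h : Sm G K C) (hC : 0 ≤ C) :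
    Continuous (fderiv ℝ G) := by
  refine (LipschitzWith.of_dist_le_mul (K := ⟨C, hC⟩) fun x y => ?_).continuous
  rw [dist_eq_norm, dist_eq_norm]
  exact h.lip x y

lemma Sm.integrable {G : E → ℝ} {K C : ℝ} (h : Sm G K C) (μ : Measure E) [IsGaussian μ] (s : ℝ)
    (x : E) : Integrable (fun z => G (x + s • z)) μ := by
  have hc := h.diff.continuous
  refine integrable_lip (K := K * |s|) (by fun_prop) fun a b => ?_
  have := h.abs_sub_le (x + s • a) (s • b)
  rw [norm_smul, Real.norm_eq_abs] at this
  rw [smul_add, ← add_assoc, mul_assoc]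
  exact this

lemma Sm.avg {G : E → ℝ} {K C : ℝ} (h : Sm G K C) (hC : 0 ≤ C) (s : ℝ) :
    Sm (fun x => ∫ z, G (x + s • z) ∂(stdGaussian E)) K C := by
  have hc := h.diff.continuous
  have hcf := h.cont_fderiv hC
  have hd : ∀ x, HasFDerivAt (fun x => ∫ z, G (x + s • z) ∂(stdGaussian E))
      (∫ z, fderiv ℝ G (x + s • z) ∂(stdGaussian E)) x := by
    intro x
    refine hasFDerivAt_integral_of_dominated_of_fderiv_le (𝕜 := ℝ) (s := Set.univ) (bound := fun _ => K)
      (F' := fun x z => fderiv ℝ G (x + s • z)) Filter.univ_mem ?_ ?_ ?_ ?_ ?_ ?_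
    · exact Filter.Eventually.of_forall fun y => by
        exact Continuous.aestronglyMeasurable (by fun_prop)
    · exact h.integrable _ s x
    · exact Continuous.aestronglyMeasurable (by fun_prop)
    · exact Filter.Eventually.of_forall fun z y _ => h.bd _
    · exact integrable_const _
    · refine Filter.Eventually.of_forall fun z y _ => ?_
      have := (h.diff (y + s • z)).hasFDerivAt
      exact (hasFDerivAt_comp_add_right (s • z)).2 this
  have hi : ∀ x, Integrable (fun z => fderiv ℝ G (x + s • z)) (stdGaussian E) := fun x =>
    (integrable_const K).mono' (Continuous.aestronglyMeasurable (by fun_prop))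
      (Filter.Eventually.of_forall fun z => h.bd _)
  refine ⟨fun x => (hd x).differentiableAt, fun x => ?_, fun x y => ?_⟩
  · rw [(hd x).fderiv]
    have := norm_integral_le_of_norm_le_const (μ := stdGaussian E) (C := K)
      (Filter.Eventually.of_forall fun z => h.bd (x + s • z))
    simpa using this
  · rw [(hd x).fderiv, (hd y).fderiv, ← integral_sub (hi x) (hi y)]
    have := norm_integral_le_of_norm_le_const (μ := stdGaussian E) (C := C * ‖x - y‖)
      (f := fun z => fderiv ℝ G (x + s • z) - fderiv ℝ G (y + s • z))
      (Filter.Eventually.of_forall fun z => by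
        have := h.lip (x + s • z) (y + s • z)
        rwa [add_sub_add_right_eq_sub] at this)
    simpa using this

noncomputable def Ng (E : Type*) [NormedAddCommGroup E] [InnerProductSpace ℝ E]
    [FiniteDimensional ℝ E] [MeasurableSpace E] [BorelSpace E] (a : ℝ) : Measure E :=
  (stdGaussian E).map (a • ContinuousLinearMap.id ℝ E)

instance (a : ℝ) : IsGaussian (Ng E a) := by unfold Ng; infer_instance

lemma charFun_Ng (a : ℝ) (t : E) :
    charFun (Ng E a) t = Complex.exp (- (a ^ 2 * ‖t‖ ^ 2 : ℝ) / 2) := by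
  have : Ng E a = (stdGaussian E).map (fun x => a • x) := rfl
  rw [this, charFun_map_smul, charFun_stdGaussian, norm_smul]
  congr 2
  rw [← Complex.ofReal_pow, mul_pow, Real.norm_eq_abs, sq_abs]

lemma Ng_conv (a b c : ℝ) (h : a ^ 2 + b ^ 2 = c ^ 2) : Ng E a ∗ Ng E b = Ng E c := by
  apply Measure.ext_of_charFun
  ext t
  rw [charFun_conv, charFun_Ng, charFun_Ng, charFun_Ng, ← Complex.exp_add, ← h]
  congr 1; push_cast; ring

lemma Ng_one : Ng E 1 = stdGaussian E := by
  apply Measure.ext_of_charFun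
  ext t
  rw [charFun_Ng, charFun_stdGaussian]
  simp

lemma Ng_zero : Ng E 0 = Measure.dirac 0 := by
  apply Measure.ext_of_charFun
  ext t
  rw [charFun_Ng]
  simp

lemma integral_Ng (a : ℝ) {f : E → ℝ} (hf : Continuous f) :
    ∫ x, f x ∂(Ng E a) = ∫ z, f (a • z) ∂(stdGaussian E) := by
  have : Ng E a = (stdGaussian E).map (fun x => a • x) := rfl
  rw [this, integral_map (by fun_prop) (by exact hf.aestronglyMeasurable)]

lemma iter {K C A s : ℝ} (hC : 0 ≤ C) (hs : 0 ≤ s) (hs1 : s ≤ 1)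
    (hA : ∀ G : E → ℝ, Sm G K C → ∀ x : E,
    ∫ z, Real.exp (G (x + s • z)) ∂(stdGaussian E) ≤
      Real.exp (∫ z, G (x + s • z) ∂(stdGaussian E) + s ^ 2 * K ^ 2 / 2 + s ^ 3 * A)) (k : ℕ) :
    ∀ G : E → ℝ, Sm G K C →
    ∫ z, Real.exp (G z) ∂(Ng E (√k * s)) ≤
      Real.exp (∫ z, G z ∂(Ng E (√k * s)) + k * (s ^ 2 * K ^ 2 / 2 + s ^ 3 * A)) := by
  induction k with
  | zero => intro G hG; simp [Ng_zero]
  | succ k ih =>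
    intro G hG
    have hc := hG.diff.continuous
    have hcv : Ng E (√k * s) ∗ Ng E s = Ng E (√(k + 1 : ℕ) * s) := by
      apply Ng_conv
      rw [mul_pow, mul_pow, Real.sq_sqrt (by positivity), Real.sq_sqrt (by positivity)]
      push_cast; ring
    have hP := hG.avg hC s
    have hPc := hP.diff.continuous
    have i1 : Integrable (fun z => Real.exp (G z)) (Ng E (√k * s) ∗ Ng E s) := by
      rw [hcv]; exact integrable_exp_lip hc hG.abs_sub_le
    have i2 : Integrable G (Ng E (√k * s) ∗ Ng E s) := by
      rw [hcv]; exact integrable_lip hc hG.abs_sub_le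
    rw [← hcv, integral_conv i1, integral_conv i2]
    have e1 : ∀ x, ∫ y, Real.exp (G (x + y)) ∂(Ng E s) =
        ∫ z, Real.exp (G (x + s • z)) ∂(stdGaussian E) := fun x =>
      integral_Ng s (f := fun y => Real.exp (G (x + y))) (by fun_prop)
    have e2 : ∀ x, ∫ y, G (x + y) ∂(Ng E s) =
        ∫ z, G (x + s • z) ∂(stdGaussian E) := fun x =>
      integral_Ng s (f := fun y => (G (x + y))) (by fun_prop)
    simp_rw [e1, e2]
    have i3 : Integrable (fun x => Real.exp (∫ z, G (x + s • z) ∂(stdGaussian E)))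
      (Ng E (√k * s)) := integrable_exp_lip hPc hP.abs_sub_le
    calc _ ≤ ∫ x, Real.exp (∫ z, G (x + s • z) ∂(stdGaussian E)) *
              Real.exp (s ^ 2 * K ^ 2 / 2 + s ^ 3 * A) ∂(Ng E (√k * s)) := by
          refine integral_mono_of_nonneg (Filter.Eventually.of_forall fun x =>
            integral_nonneg fun z => (Real.exp_pos _).le) (i3.mul_const _)
            (Filter.Eventually.of_forall fun x => ?_)
          have := hA G hG x
          rwa [add_assoc, Real.exp_add] at this
      _ ≤ _ := by
          rw [integral_mul_const]
          have := ih _ hP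
          refine (mul_le_mul_of_nonneg_right this (Real.exp_pos _).le).trans ?_
          rw [← Real.exp_add]
          apply le_of_eq; congr 1; push_cast; ring

lemma smooth_conc {K C : ℝ} (hK : 0 ≤ K) (hC : 0 ≤ C) (G : E → ℝ) (hG : Sm G K C) :
    ∫ z, Real.exp (G z) ∂(stdGaussian E) ≤
      Real.exp (∫ z, G z ∂(stdGaussian E) + K ^ 2 / 2) := by
  obtain ⟨A, hA0, hA⟩ := one_step (E := E) K C hK hC
  have key : ∀ m : ℕ, ∫ z, Real.exp (G z) ∂(stdGaussian E) ≤
      Real.exp (∫ z, G z ∂(stdGaussian E) + K ^ 2 / 2 + A * (√((m:ℝ) + 1))⁻¹) := by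
    intro m
    set w := √((m:ℝ) + 1) with hw
    have hw0 : 0 < w := by positivity
    have hw1 : 1 ≤ w := by rw [hw]; apply Real.one_le_sqrt.2; simp
    have hww : w ^ 2 = m + 1 := Real.sq_sqrt (by positivity)
    have := iter (E := E) (K := K) (C := C) (A := A) (s := w⁻¹) hC (by positivity)
      (inv_le_one_of_one_le₀ hw1)
      (fun G hG x => hA G hG _ (by positivity) (inv_le_one_of_one_le₀ hw1) x) (m + 1) G hG
    have e : √((m + 1 : ℕ) : ℝ) * w⁻¹ = 1 := by
      push_cast; rw [← hw]; field_simp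
    rw [e, Ng_one] at this
    refine this.trans (le_of_eq ?_)
    congr 1
    push_cast
    rw [← hww]; field_simp; ring
  have lim : Filter.Tendsto (fun m : ℕ =>
      Real.exp (∫ z, G z ∂(stdGaussian E) + K ^ 2 / 2 + A * (√((m:ℝ) + 1))⁻¹)) Filter.atTop
      (nhds (Real.exp (∫ z, G z ∂(stdGaussian E) + K ^ 2 / 2 + A * 0))) := by
    refine (Real.continuous_exp.tendsto _).comp (tendsto_const_nhds.add (tendsto_const_nhds.mul ?_))
    refine Filter.Tendsto.inv_tendsto_atTop (Real.tendsto_sqrt_atTop.comp ?_)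
    exact Filter.tendsto_atTop_add_const_right _ _ tendsto_natCast_atTop_atTop
  have := ge_of_tendsto' lim key
  simpa using this

open scoped Convolution in
lemma exists_smooth {K δ : ℝ} (hK : 0 ≤ K) (hδ : 0 < δ) (F : E → ℝ)
    (hF : ∀ x y, |F x - F y| ≤ K * ‖x - y‖) :
    ∃ G : E → ℝ, ∃ C : ℝ, 0 ≤ C ∧ Sm G K C ∧ ∀ x, |G x - F x| ≤ K * δ := by
  have hFc : Continuous F := by
    refine (LipschitzWith.of_dist_le_mul (K := ⟨K, hK⟩) fun x y => ?_).continuous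
    rw [dist_eq_norm, dist_eq_norm]; exact hF x y
  let φ : ContDiffBump (0 : E) := ⟨δ / 2, δ, by positivity, by linarith⟩
  let f := φ.normed (volume : Measure E)
  have hfc : ContDiff ℝ 1 f := φ.contDiff_normed
  have hfs : HasCompactSupport f := φ.hasCompactSupport_normed
  have hfi : Integrable f := φ.integrable_normed
  have hgi : Integrable (fderiv ℝ f) :=
    (hfc.continuous_fderiv (by norm_num)).integrable_of_hasCompactSupport (hfs.fderiv (𝕜 := ℝ))
  let G : E → ℝ := f ⋆[ContinuousLinearMap.lsmul ℝ ℝ, volume] F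
  have hGF : ∀ x, |G x - F x| ≤ K * δ := by
    intro x
    have := φ.dist_normed_convolution_le (μ := volume) (g := F) (x₀ := x) (ε := K * δ)
      hFc.aestronglyMeasurable (fun y hy => by
        rw [Real.dist_eq]
        refine (hF y x).trans ?_
        rw [mem_ball_iff_norm] at hy
        have : ‖y - x‖ ≤ δ := hy.le
        gcongr)
    rwa [Real.dist_eq] at this
  have hder : ∀ x, HasFDerivAt G ((fderiv ℝ f ⋆[(ContinuousLinearMap.lsmul ℝ ℝ : ℝ →L[ℝ] ℝ →L[ℝ] ℝ).precompL E, volume] F) x) x :=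
    fun x => hfs.hasFDerivAt_convolution_left _ hfc hFc.locallyIntegrable x
  have hexf : ∀ x, Integrable fun t => f t * F (x - t) := fun x => by
    have := hfs.convolutionExists_left (ContinuousLinearMap.lsmul ℝ ℝ : ℝ →L[ℝ] ℝ →L[ℝ] ℝ)
      hfc.continuous (hFc.locallyIntegrable (μ := volume)) x
    exact this
  have hGlip : ∀ x y, |G x - G y| ≤ K * ‖x - y‖ := by
    intro x y
    have e : G x - G y = ∫ t, f t * (F (x - t) - F (y - t)) := by
      simp_rw [mul_sub]
      rw [integral_sub (hexf x) (hexf y)]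
      rfl
    rw [e, ← Real.norm_eq_abs]
    refine (norm_integral_le_of_norm_le (hfi.mul_const (K * ‖x - y‖))
      (Filter.Eventually.of_forall fun t => ?_)).trans (le_of_eq ?_)
    · rw [norm_mul, Real.norm_of_nonneg (φ.nonneg_normed t)]
      gcongr
      · exact φ.nonneg_normed t
      · have := hF (x - t) (y - t)
        rwa [sub_sub_sub_cancel_right] at this
    · rw [integral_mul_const, φ.integral_normed, one_mul]
  set L := (ContinuousLinearMap.lsmul ℝ ℝ : ℝ →L[ℝ] ℝ →L[ℝ] ℝ).precompL E with hL
  have hexg : ∀ x, Integrable fun t => L (fderiv ℝ f t) (F (x - t)) := fun x =>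
    (hfs.fderiv (𝕜 := ℝ)).convolutionExists_left L
      (hfc.continuous_fderiv (by norm_num)) (hFc.locallyIntegrable (μ := volume)) x
  have hLe : ∀ g c, L g c = c • g := fun g c => by
    ext v
    simp [hL, ContinuousLinearMap.precompL_apply, mul_comm]
  refine ⟨G, (∫ t, ‖fderiv ℝ f t‖) * K, ?_, ⟨fun x => (hder x).differentiableAt, ?_, ?_⟩, hGF⟩
  · have : 0 ≤ ∫ t, ‖fderiv ℝ f t‖ := integral_nonneg fun t => norm_nonneg _
    positivity
  · intro x
    have : LipschitzWith ⟨K, hK⟩ G := LipschitzWith.of_dist_le_mul fun x y => by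
      rw [dist_eq_norm, dist_eq_norm]; exact hGlip x y
    exact norm_fderiv_le_of_lipschitz ℝ this
  · intro x y
    rw [(hder x).fderiv, (hder y).fderiv]
    simp only [convolution_def]
    rw [← integral_sub (hexg x) (hexg y)]
    have hi := hgi.norm.mul_const (K * ‖x - y‖)
    refine (norm_integral_le_of_norm_le hi
      (Filter.Eventually.of_forall fun t => ?_)).trans (le_of_eq ?_)
    · rw [← map_sub, hLe, norm_smul, mul_comm]
      gcongr
      have := hF (x - t) (y - t)
      rwa [sub_sub_sub_cancel_right] at this
    · rw [integral_mul_const]; ring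

lemma lip_conc {K : ℝ} (hK : 0 ≤ K) (F : E → ℝ) (hF : ∀ x y, |F x - F y| ≤ K * ‖x - y‖) :
    Integrable F (stdGaussian E) ∧ Integrable (fun x => Real.exp (F x)) (stdGaussian E) ∧
    ∫ z, Real.exp (F z) ∂(stdGaussian E) ≤
      Real.exp (∫ z, F z ∂(stdGaussian E) + K ^ 2 / 2) := by
  have hFc : Continuous F := by
    refine (LipschitzWith.of_dist_le_mul (K := ⟨K, hK⟩) fun x y => ?_).continuous
    rw [dist_eq_norm, dist_eq_norm]; exact hF x y
  have hF' : ∀ x y, |F (x + y) - F x| ≤ K * ‖y‖ := fun x y => by simpa using hF (x + y) x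
  have hi := integrable_lip (μ := stdGaussian E) hFc hF'
  have hie := integrable_exp_lip (μ := stdGaussian E) hFc hF'
  refine ⟨hi, hie, ?_⟩
  have key : ∀ δ ∈ Set.Ioi (0:ℝ), ∫ z, Real.exp (F z) ∂(stdGaussian E) ≤
      Real.exp (∫ z, F z ∂(stdGaussian E) + K ^ 2 / 2 + 2 * (K * δ)) := by
    intro δ hδ
    obtain ⟨G, C, hC, hG, hGF⟩ := exists_smooth hK hδ F hF
    have hc := hG.diff.continuous
    have hGi := integrable_lip (μ := stdGaussian E) hc hG.abs_sub_le
    have hGe := integrable_exp_lip (μ := stdGaussian E) hc hG.abs_sub_le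
    have h1 : ∫ z, Real.exp (F z) ∂(stdGaussian E) ≤
        ∫ z, Real.exp (G z) * Real.exp (K * δ) ∂(stdGaussian E) := by
      refine integral_mono hie (hGe.mul_const _) fun z => ?_
      simp only [← Real.exp_add]
      apply Real.exp_le_exp.2
      linarith [neg_abs_le (G z - F z), hGF z]
    have h2 : ∫ z, G z ∂(stdGaussian E) ≤ ∫ z, F z ∂(stdGaussian E) + K * δ := by
      have : ∫ z, G z ∂(stdGaussian E) ≤ ∫ z, (F z + K * δ) ∂(stdGaussian E) :=
        integral_mono hGi (hi.add (integrable_const _)) fun z => by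
          simp only
          linarith [le_abs_self (G z - F z), hGF z]
      rw [integral_add hi (integrable_const _)] at this
      simpa using this
    rw [integral_mul_const] at h1
    refine h1.trans ((mul_le_mul_of_nonneg_right (smooth_conc hK hC G hG) (Real.exp_pos _).le).trans ?_)
    rw [← Real.exp_add]
    apply Real.exp_le_exp.2
    linarith
  have lim : Filter.Tendsto (fun δ : ℝ =>
      Real.exp (∫ z, F z ∂(stdGaussian E) + K ^ 2 / 2 + 2 * (K * δ))) (nhdsWithin 0 (Set.Ioi 0))
      (nhds (Real.exp (∫ z, F z ∂(stdGaussian E) + K ^ 2 / 2 + 2 * (K * 0)))) := by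
    refine Filter.Tendsto.mono_left (Continuous.tendsto (by fun_prop) 0) nhdsWithin_le_nhds
  have := ge_of_tendsto lim (Filter.eventually_of_mem self_mem_nhdsWithin key)
  simpa using this

lemma lip_subG {K : ℝ≥0} (F : E → ℝ) (hF : ∀ x y, |F x - F y| ≤ K * ‖x - y‖) :
    HasSubgaussianMGF (fun x => F x - ∫ z, F z ∂(stdGaussian E)) (K ^ 2) (stdGaussian E) := by
  have h : ∀ t : ℝ, ∀ x y, |t * F x - t * F y| ≤ (|t| * K) * ‖x - y‖ := fun t x y => by
    rw [← mul_sub, abs_mul, mul_assoc]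
    gcongr
    exact hF x y
  have e : ∀ t x, Real.exp (t * (F x - ∫ z, F z ∂(stdGaussian E))) =
      Real.exp (t * F x) * Real.exp (- (t * ∫ z, F z ∂(stdGaussian E))) := fun t x => by
    rw [← Real.exp_add]; ring_nf
  refine ⟨fun t => ?_, fun t => ?_⟩
  · simp_rw [e]
    exact (lip_conc (by positivity) _ (h t)).2.1.mul_const _
  · rw [mgf]
    simp_rw [e]
    rw [integral_mul_const]
    refine (mul_le_mul_of_nonneg_right (lip_conc (by positivity) _ (h t)).2.2
      (Real.exp_pos _).le).trans ?_
    rw [← Real.exp_add, integral_const_mul, mul_pow, sq_abs]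
    apply le_of_eq; congr 1; push_cast; ring
end conc2

lemma lq_nonneg (q : ℝ≥0∞) {L : ℕ} (v : Fin L → ℝ) : 0 ≤ lqNorm q v := ENNReal.toReal_nonneg

lemma lq_mono (q : ℝ≥0∞) {L : ℕ} (u v : Fin L → ℝ) (h : ∀ j, |u j| ≤ v j) :
    lqNorm q u ≤ lqNorm q v :=
  ENNReal.toReal_mono (lq_fin q v) (eLpNorm_mono_real h)

lemma lq_smul (q : ℝ≥0∞) {L : ℕ} (c : ℝ) (v : Fin L → ℝ) :
    lqNorm q (fun j => c * v j) = |c| * lqNorm q v := by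
  have : (fun j => c * v j) = c • v := rfl
  rw [this, lqNorm, eLpNorm_const_smul, ENNReal.toReal_mul]
  simp [lqNorm]

lemma lq_sub_le (q : ℝ≥0∞) (hq : 1 ≤ q) {L : ℕ} (u v : Fin L → ℝ) :
    lqNorm q u - lqNorm q v ≤ lqNorm q (u - v) := by
  have h : eLpNorm ((u - v) + v) q Measure.count ≤ _ :=
    eLpNorm_add_le (.of_discrete) (.of_discrete) hq
  rw [sub_add_cancel] at h
  have h2 := ENNReal.toReal_mono (ENNReal.add_ne_top.2 ⟨lq_fin q (u - v), lq_fin q v⟩) h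
  rw [ENNReal.toReal_add (lq_fin q (u - v)) (lq_fin q v)] at h2
  unfold lqNorm
  linarith

noncomputable def Fq (q : ℝ≥0∞) {n L : ℕ} (X : Fin n → Fin L → ℝ) (w : Fin n → ℝ) : ℝ :=
  lqNorm q (fun j => (1 / (n : ℝ)) * ∑ i, X i j * w i)

lemma Fq_smul (q : ℝ≥0∞) {n L : ℕ} (X : Fin n → Fin L → ℝ) (w : Fin n → ℝ) (c : ℝ) (hc : 0 ≤ c) :
    Fq q X (fun i => c * w i) = c * Fq q X w := by
  unfold Fq
  nth_rw 2 [← abs_of_nonneg hc]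
  rw [← lq_smul]
  congr 1; ext j
  rw [mul_left_comm c]
  congr 1
  rw [Finset.mul_sum]
  exact Finset.sum_congr rfl fun i _ => by ring

lemma Fq_bound (q : ℝ≥0∞) {n L : ℕ} (hn : 1 ≤ n) (X : Fin n → Fin L → ℝ)
    (w : EuclideanSpace ℝ (Fin n)) :
    Fq q X w.ofLp ≤ (Nq q X / √n) * ‖w‖ := by
  have hn0 : (0:ℝ) < n := by exact_mod_cast hn
  have e : (Nq q X / √n) * ‖w‖ = |‖w‖ / √n| * Nq q X := by
    rw [abs_of_nonneg (by positivity)]; ring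
  rw [e, Nq, ← lq_smul]
  apply lq_mono
  intro j
  have cs : |∑ i, X i j * w i| ≤ √(∑ i, X i j ^ 2) * ‖w‖ := by
    rw [EuclideanSpace.norm_eq]
    simp only [Real.norm_eq_abs, sq_abs]
    rw [← Real.sqrt_mul (by positivity)]
    exact Real.abs_le_sqrt (Finset.sum_mul_sq_le_sq_mul_sq _ _ _)
  rw [abs_mul, abs_of_pos (by positivity), Real.sqrt_mul (by positivity), Real.sqrt_div (by simp),
    Real.sqrt_one]
  have hs : √(n:ℝ) * √n = n := Real.mul_self_sqrt hn0.le
  calc 1 / (n:ℝ) * |∑ i, X i j * w i| ≤ 1 / (n:ℝ) * (√(∑ i, X i j ^ 2) * ‖w‖) := by gcongr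
    _ = _ := by field_simp; rw [Real.sq_sqrt hn0.le]; ring

lemma Fq_sub (q : ℝ≥0∞) (hq : 1 ≤ q) {n L : ℕ} (X : Fin n → Fin L → ℝ) (u v : Fin n → ℝ) :
    Fq q X u - Fq q X v ≤ Fq q X (u - v) := by
  refine (lq_sub_le q hq _ _).trans (le_of_eq ?_)
  unfold Fq
  congr 1; ext j
  simp only [Pi.sub_apply]
  rw [← mul_sub, ← Finset.sum_sub_distrib]
  congr 1
  exact Finset.sum_congr rfl fun i _ => by ring

lemma Fq_lip (q : ℝ≥0∞) (hq : 1 ≤ q) {n L : ℕ} (hn : 1 ≤ n) (X : Fin n → Fin L → ℝ)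
    (u v : EuclideanSpace ℝ (Fin n)) :
    |Fq q X u.ofLp - Fq q X v.ofLp| ≤ (Nq q X / √n) * ‖u - v‖ := by
  rw [abs_le]
  have h1 := (Fq_sub q hq X u.ofLp v.ofLp).trans (Fq_bound q hn X (u - v))
  have h2 := (Fq_sub q hq X v.ofLp u.ofLp).trans (Fq_bound q hn X (v - u))
  rw [norm_sub_rev] at h2
  constructor <;> linarith

lemma gaussianVec_eq (n : ℕ) (σ : ℝ) : gaussianVec n σ =
    Measure.pi (fun _ => gaussianReal 0 (NNReal.mk (σ ^ 2) (sq_nonneg σ))) := rfl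

lemma gaussianVec_one (n : ℕ) : gaussianVec n 1 = Measure.pi (fun _ => gaussianReal 0 1) := by
  rw [gaussianVec_eq]
  congr 1; ext1 i; congr 1; ext; simp

instance (n : ℕ) (σ : ℝ) : IsProbabilityMeasure (gaussianVec n σ) := by
  rw [gaussianVec_eq]; infer_instance

lemma gaussianVec_map (n : ℕ) (σ : ℝ) :
    gaussianVec n σ = (gaussianVec n 1).map (fun w i => σ * w i) := by
  rw [gaussianVec_one]
  have := Measure.pi_map_pi (μ := fun _ : Fin n => gaussianReal 0 1) (f := fun _ x => σ * x)
    (fun i => by fun_prop)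
  rw [this, gaussianVec_eq]
  congr 1; ext1 i
  rw [gaussianReal_map_const_mul]
  congr 1
  · simp
  · ext; simp

lemma gaussianVec_toLp (n : ℕ) :
    (gaussianVec n 1).map (WithLp.toLp 2) = stdGaussian (EuclideanSpace ℝ (Fin n)) := by
  rw [gaussianVec_one]; exact map_pi_eq_stdGaussian

lemma Fq_cont (q : ℝ≥0∞) (hq : 1 ≤ q) {n L : ℕ} (hn : 1 ≤ n) (X : Fin n → Fin L → ℝ) :
    Continuous (fun w : EuclideanSpace ℝ (Fin n) => Fq q X w.ofLp) := by
  have h0 : 0 ≤ Nq q X / √n := div_nonneg (lq_nonneg _ _) (Real.sqrt_nonneg _)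
  refine (LipschitzWith.of_dist_le_mul (K := ⟨_, h0⟩) fun x y => ?_).continuous
  rw [dist_eq_norm, dist_eq_norm]; exact Fq_lip q hq hn X x y

lemma Fq_subG (q : ℝ≥0∞) (hq : 1 ≤ q) {n L : ℕ} (hn : 1 ≤ n) (X : Fin n → Fin L → ℝ) (c : ℝ≥0)
    (hc : (c:ℝ) = Nq q X / √n) :
    HasSubgaussianMGF (fun w => Fq q X w - ∫ z, Fq q X z ∂(gaussianVec n 1)) (c ^ 2)
      (gaussianVec n 1) := by
  have hF := Fq_cont q hq hn X
  have h := lip_subG (K := c) (fun w : EuclideanSpace ℝ (Fin n) => Fq q X w.ofLp)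
    (fun x y => by rw [hc]; exact Fq_lip q hq hn X x y)
  rw [← gaussianVec_toLp, integral_map (by fun_prop) hF.aestronglyMeasurable] at h
  exact HasSubgaussianMGF.of_map (Y := WithLp.toLp 2) (by fun_prop) h

lemma subG_eval {Ω : Type*} [MeasurableSpace Ω] {μ : Measure Ω} [IsProbabilityMeasure μ] {R : ℕ}
    {f : Ω → ℝ} {c : ℝ≥0} (hf : HasSubgaussianMGF f c μ) (r : Fin R) :
    HasSubgaussianMGF (fun z : Fin R → Ω => f (z r)) c (Measure.pi fun _ => μ) := by
  have hmp : MeasurePreserving (fun z : Fin R → Ω => z r) (Measure.pi fun _ => μ) μ :=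
    measurePreserving_eval (fun _ : Fin R => μ) r
  rw [← hmp.map_eq] at hf
  exact HasSubgaussianMGF.of_map (X := f) (Y := fun z : Fin R → Ω => z r)
    hmp.measurable.aemeasurable hf

/-- Monte Carlo upper-deviation bound, eq. (c2_u). -/
theorem monte_carlo_upper_deviation
    (n L R : ℕ) (hn : 1 ≤ n) (hL : 1 ≤ L) (hR : 1 ≤ R) (X : Fin n → Fin L → ℝ)
    (σ : ℝ) (hσ : 0 < σ) (q : ℝ≥0∞) (hq : 1 ≤ q) (t : ℝ) (ht : 0 ≤ t) :
    ((Measure.pi (fun _ : Fin R => gaussianVec n 1))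
        {z : Fin R → Fin n → ℝ |
          (σ / R) * ∑ r, lqNorm q (fun j => (1 / (n : ℝ)) * ∑ i, X i j * z r i)
            ≥ (∫ w, lqNorm q (fun j => (1 / (n : ℝ)) * ∑ i, X i j * w i)
                ∂(gaussianVec n σ)) + t}).toReal
      ≤ Real.exp (-(n * R * t ^ 2) / (2 * σ ^ 2 * (Nq q X) ^ 2)) := by
  have hn0 : (0:ℝ) < n := by exact_mod_cast hn
  have hR0 : (0:ℝ) < R := by exact_mod_cast hR
  have hFc : Continuous (Fq q X) :=
    (Fq_cont q hq hn X).comp (PiLp.continuous_toLp 2 (fun _ : Fin n => ℝ))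
  have hint : ∫ w, Fq q X w ∂(gaussianVec n σ) = σ * ∫ w, Fq q X w ∂(gaussianVec n 1) := by
    rw [gaussianVec_map n σ, integral_map (Measurable.aemeasurable (by fun_prop)) hFc.aestronglyMeasurable,
      ← integral_const_mul]
    simp_rw [Fq_smul q X _ σ hσ.le]
  set M := ∫ w, Fq q X w ∂(gaussianVec n 1) with hM
  have h0 : 0 ≤ Nq q X / √n := div_nonneg (lq_nonneg _ _) (Real.sqrt_nonneg _)
  obtain ⟨c, hc⟩ : ∃ c : ℝ≥0, (c : ℝ) = Nq q X / √n := ⟨⟨_, h0⟩, rfl⟩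
  have hsub := Fq_subG q hq hn X c hc
  rw [← hM] at hsub
  have hind : iIndepFun (fun r (z : Fin R → Fin n → ℝ) => Fq q X (z r) - M)
      (Measure.pi (fun _ : Fin R => gaussianVec n 1)) :=
    iIndepFun_pi (X := fun _ w => Fq q X w - M) (fun r => by
      have := hFc.measurable
      fun_prop)
  have hs : ∀ r ∈ (Finset.univ : Finset (Fin R)), HasSubgaussianMGF
      (fun (z : Fin R → Fin n → ℝ) => Fq q X (z r) - M) (c ^ 2)
      (Measure.pi (fun _ : Fin R => gaussianVec n 1)) := by
    intro r _
    exact subG_eval hsub r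
  have hmain := HasSubgaussianMGF.measure_sum_ge_le_of_iIndepFun hind (c := fun _ => c ^ 2) (s := Finset.univ) hs (ε := R * t / σ)
    (by positivity)
  have hset : {z : Fin R → Fin n → ℝ |
          (σ / R) * ∑ r, lqNorm q (fun j => (1 / (n : ℝ)) * ∑ i, X i j * z r i)
            ≥ (∫ w, lqNorm q (fun j => (1 / (n : ℝ)) * ∑ i, X i j * w i)
                ∂(gaussianVec n σ)) + t} =
      {z | R * t / σ ≤ ∑ r, (Fq q X (z r) - M)} := by
    change {z : Fin R → Fin n → ℝ | (σ / R) * ∑ r, Fq q X (z r) ≥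
      (∫ w, Fq q X w ∂(gaussianVec n σ)) + t} = _
    rw [hint]
    ext z
    simp only [Set.mem_ofPred_eq, ge_iff_le, Finset.sum_sub_distrib, Finset.sum_const,
      Finset.card_univ, Fintype.card_fin, nsmul_eq_mul]
    generalize ∑ r, Fq q X (z r) = S
    rw [div_mul_eq_mul_div, le_div_iff₀ hR0, div_le_iff₀ hσ]
    constructor <;> intro h <;> nlinarith
  rw [hset]
  refine hmain.trans (le_of_eq ?_)
  congr 1
  simp only [Finset.sum_const, Finset.card_univ, Fintype.card_fin]
  push_cast
  rw [nsmul_eq_mul, hc, div_pow, div_pow, Real.sq_sqrt hn0.le]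
  by_cases hN : Nq q X = 0
  · simp [hN]
  · field_simp
end
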